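/- Let f be a non wandering positive twist map of the closed annulus A = 𝕋 × [0,1] such that no essential simple loop meeting each vertical segment {x}×[0,1] in exactly one point is f-invariant, except C₀ and C₁. Then there exist points z and z' in the open annulus 𝕋 × (0,1) such that lim_{k→−∞} d(fᵏ(z), C₀) = lim_{k→+∞} d(fᵏ(z), C₁) = 0 and lim_{k→−∞} d(fᵏ(z'), C₁) = lim_{k→+∞} d(fᵏ(z'), C₀) = 0. -/

import Mathlib

open Set Filter Topology MeasureTheory

noncomputable section

/-- The circle `𝕋 = ℝ/ℤ`. -/
abbrev 𝕋 : Type := AddCircle (1 : ℝ)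

/-- The closed annulus `A = 𝕋 × [0,1]`. -/
abbrev Ann : Type := 𝕋 × ↥(Set.Icc (0:ℝ) 1)

/-- The universal cover `Ã = ℝ × [0,1]`. -/
abbrev StripA : Type := ℝ × ↥(Set.Icc (0:ℝ) 1)

/-- The covering projection `π : Ã → A`. -/
def annProj : StripA → Ann := fun z => ((z.1 : 𝕋), z.2)

/-- The deck translation `T(x̃,y) = (x̃+1,y)`. -/
def deckT : StripA → StripA := fun z => (z.1 + 1, z.2)

/-- The iterated deck translation `T^p`, `p ∈ ℤ`. -/
def deckZ (p : ℤ) : StripA → StripA := fun z => (z.1 + (p : ℝ), z.2)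

/-- The boundary circle `C₀ = 𝕋 × {0}`. -/
def C0 : Set Ann := {z | (z.2 : ℝ) = 0}

/-- The boundary circle `C₁ = 𝕋 × {1}`. -/
def C1 : Set Ann := {z | (z.2 : ℝ) = 1}

/-- A point of `Ã` on the boundary line `ℝ × {0}`. -/
def bd0 (x : ℝ) : StripA := (x, ⟨0, by norm_num⟩)

/-- A point of `Ã` on the boundary line `ℝ × {1}`. -/
def bd1 (x : ℝ) : StripA := (x, ⟨1, by norm_num⟩)

/-- A homeomorphism of the closed annulus isotopic to the identity, together with a
chosen lift to the universal cover.  (A homeomorphism of `A` is isotopic to the identity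
iff it admits a lift commuting with the deck translation and preserving each boundary
line of the strip.) -/
structure AnnulusHomeo where
  toFun : Ann ≃ₜ Ann
  lift : StripA ≃ₜ StripA
  lift_proj : ∀ z : StripA, annProj (lift z) = toFun (annProj z)
  lift_deck : ∀ z : StripA, lift (deckT z) = deckT (lift z)
  lift_bd0 : ∀ z : StripA, (z.2 : ℝ) = 0 → ((lift z).2 : ℝ) = 0

/-- The iterate `f^k`, `k ∈ ℤ`. -/
def AnnulusHomeo.iter (h : AnnulusHomeo) (k : ℤ) : Ann → Ann :=
  fun z => ((h.toFun.toEquiv : Equiv.Perm Ann) ^ k) z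

/-- The iterate `f̃^k` of the lift, `k ∈ ℤ`. -/
def AnnulusHomeo.liftIter (h : AnnulusHomeo) (k : ℤ) : StripA → StripA :=
  fun z => ((h.lift.toEquiv : Equiv.Perm StripA) ^ k) z

/-- `f` is non wandering: every nonempty open set meets one of its forward iterates. -/
def NonWandering (h : AnnulusHomeo) : Prop :=
  ∀ U : Set Ann, IsOpen U → U.Nonempty → ∃ k : ℕ, 0 < k ∧ (h.iter k '' U ∩ U).Nonempty

/-- The closed strip `ℝ × [0,1]` inside the plane. -/
def stripS : Set (ℝ × ℝ) := {p | p.2 ∈ Set.Icc (0:ℝ) 1}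

/-- A positive twist map: a `C¹` diffeomorphism of the annulus, isotopic to the identity,
whose lift `F` to the strip (together with its inverse `G`) is continuously differentiable
and satisfies `∂(p̃₁ ∘ f̃)/∂y > 0`, i.e. the first component of `DF(z)·(0,1)` is positive. -/
structure PositiveTwistMap extends AnnulusHomeo where
  F : ℝ × ℝ → ℝ × ℝ
  F' : ℝ × ℝ → (ℝ × ℝ) →L[ℝ] (ℝ × ℝ)
  G : ℝ × ℝ → ℝ × ℝ
  G' : ℝ × ℝ → (ℝ × ℝ) →L[ℝ] (ℝ × ℝ)
  F_lift : ∀ z : StripA, F (z.1, (z.2 : ℝ)) = ((lift z).1, ((lift z).2 : ℝ))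
  G_lift : ∀ z : StripA, G (z.1, (z.2 : ℝ)) = ((lift.symm z).1, ((lift.symm z).2 : ℝ))
  F_hasDeriv : ∀ z ∈ stripS, HasFDerivWithinAt F (F' z) stripS z
  G_hasDeriv : ∀ z ∈ stripS, HasFDerivWithinAt G (G' z) stripS z
  F'_cont : ContinuousOn F' stripS
  G'_cont : ContinuousOn G' stripS
  twist_pos : ∀ z ∈ stripS, 0 < (F' z (0, 1)).1

/-- The oriented angle (in `(-π, π]`) from the vertical vector `(0,1)` to the vector `w`. -/
def angleFromVertical (w : ℝ × ℝ) : ℝ := Complex.arg ⟨w.2, -w.1⟩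

/-- `ρ` is the rotation number of `f` on the boundary circle `C₀`, computed with the lift. -/
def HasRotNum0 (h : AnnulusHomeo) (ρ : ℝ) : Prop :=
  ∀ x : ℝ, Tendsto (fun n : ℕ => ((h.liftIter (n : ℤ) (bd0 x)).1 - x) / (n : ℝ))
    atTop (𝓝 ρ)

/-- `ρ` is the rotation number of `f` on the boundary circle `C₁`, computed with the lift. -/
def HasRotNum1 (h : AnnulusHomeo) (ρ : ℝ) : Prop :=
  ∀ x : ℝ, Tendsto (fun n : ℕ => ((h.liftIter (n : ℤ) (bd1 x)).1 - x) / (n : ℝ))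
    atTop (𝓝 ρ)

/-- A closed `f`-invariant set `X ⊆ A` is well ordered if the first projection is injective
on `X` and the lift preserves the horizontal order on `π⁻¹(X)`. -/
def IsWellOrdered (h : AnnulusHomeo) (X : Set Ann) : Prop :=
  IsClosed X ∧ h.toFun '' X = X ∧
  Set.InjOn (fun z : Ann => z.1) X ∧
  ∀ z₁ z₂ : StripA, annProj z₁ ∈ X → annProj z₂ ∈ X → z₁.1 < z₂.1 →
    (h.lift z₁).1 < (h.lift z₂).1

/-- An essential simple loop in the annulus: the range of an injective continuous map
from the circle that is not null-homotopic. -/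
def IsEssentialSimpleLoop (Γ : Set Ann) : Prop :=
  ∃ γ : C(𝕋, Ann), Function.Injective γ ∧ ¬ γ.Nullhomotopic ∧ Set.range γ = Γ

/-- `Γ` meets each vertical segment `{x} × [0,1]` in exactly one point. -/
def MeetsVerticalsOnce (Γ : Set Ann) : Prop :=
  ∀ x : 𝕋, ∃! z : Ann, z ∈ Γ ∧ z.1 = x

/-- No essential simple loop meeting each vertical segment exactly once is invariant,
except the two boundary circles. -/
def NoInvariantTransverseLoop (h : AnnulusHomeo) : Prop :=
  ∀ Γ : Set Ann, IsEssentialSimpleLoop Γ → MeetsVerticalsOnce Γ →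
    h.toFun '' Γ = Γ → Γ = C0 ∨ Γ = C1

/-- A continuum: a nonempty compact connected set. -/
def IsContinuum (X : Set Ann) : Prop := X.Nonempty ∧ IsCompact X ∧ IsPreconnected X

/-- A lower annulus: an open set homeomorphic to `𝕋 × [0,1)` containing `C₀`. -/
def IsLowerAnnulus (U : Set Ann) : Prop :=
  IsOpen U ∧ Nonempty (↥U ≃ₜ (𝕋 × ↥(Set.Ico (0:ℝ) 1))) ∧ C0 ⊆ U

/-- A lower disk: an open set homeomorphic to `ℝ × [0,1)` meeting `C₀`. -/
def IsLowerDisk (U : Set Ann) : Prop :=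
  IsOpen U ∧ Nonempty (↥U ≃ₜ (ℝ × ↥(Set.Ico (0:ℝ) 1))) ∧ (U ∩ C0).Nonempty

/-- A lower annulus is regular if it is a connected component of the complement of an
essential simple loop. -/
def IsRegularLowerAnnulus (U : Set Ann) : Prop :=
  ∃ Γ : Set Ann, IsEssentialSimpleLoop Γ ∧ ∃ z : Ann, U = connectedComponentIn Γᶜ z

/-- A lower disk is regular if it is a connected component of the complement of a simple
arc joining two points of `C₀` and meeting `C₀` only at its endpoints, or of the
complement of an essential simple loop meeting `C₀` in exactly one point. -/
def IsRegularLowerDisk (U : Set Ann) : Prop :=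
  (∃ a : C(↥(Set.Icc (0:ℝ) 1), Ann), Function.Injective a ∧
      (∀ t : ↥(Set.Icc (0:ℝ) 1), a t ∈ C0 ↔ ((t : ℝ) = 0 ∨ (t : ℝ) = 1)) ∧
      ∃ z : Ann, U = connectedComponentIn (Set.range a)ᶜ z) ∨
  (∃ Γ : Set Ann, IsEssentialSimpleLoop Γ ∧ (∃! z : Ann, z ∈ Γ ∩ C0) ∧
      ∃ z : Ann, U = connectedComponentIn Γᶜ z)

end

namespace TwistStrip

/-- The height of a point of the strip. -/
def ht (z : StripA) : ℝ := z.2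

/-- The point of the strip with abscissa `x` and height `y`, with `y` clamped to `[0,1]`. -/
noncomputable def pt (x y : ℝ) : StripA := (x, Set.projIcc 0 1 zero_le_one y)

theorem ht_nonneg (z : StripA) : 0 ≤ ht z := z.2.2.1

theorem ht_le_one (z : StripA) : ht z ≤ 1 := z.2.2.2

theorem continuous_ht : Continuous ht := continuous_subtype_val.comp continuous_snd

theorem continuous_pt : Continuous fun p : ℝ × ℝ => pt p.1 p.2 :=
  continuous_fst.prodMk (continuous_projIcc.comp continuous_snd)

@[simp] theorem pt_fst (x y : ℝ) : (pt x y).1 = x := rfl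

theorem ht_pt {x y : ℝ} (h0 : 0 ≤ y) (h1 : y ≤ 1) : ht (pt x y) = y := by
  simp [ht, pt, Set.projIcc_of_mem zero_le_one (Set.mem_Icc.2 ⟨h0, h1⟩)]

theorem strip_ext {z w : StripA} (h1 : z.1 = w.1) (h2 : ht z = ht w) : z = w :=
  Prod.ext h1 (Subtype.ext h2)

@[simp] theorem pt_ht (z : StripA) : pt z.1 (ht z) = z :=
  strip_ext rfl (ht_pt (ht_nonneg z) (ht_le_one z))

theorem ht_lipschitz (z w : StripA) : |ht z - ht w| ≤ dist z w := by
  rw [Prod.dist_eq]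
  exact le_max_of_le_right (by rw [Subtype.dist_eq, Real.dist_eq]; rfl)

theorem fst_lipschitz (z w : StripA) : |z.1 - w.1| ≤ dist z w := by
  rw [Prod.dist_eq]
  exact le_max_of_le_left (by rw [Real.dist_eq])

theorem strip_dist_le {z w : StripA} {r : ℝ} (h1 : |z.1 - w.1| ≤ r) (h2 : |ht z - ht w| ≤ r) :
    dist z w ≤ r := by
  rw [Prod.dist_eq]
  exact max_le (by rwa [Real.dist_eq]) (by rw [Subtype.dist_eq, Real.dist_eq]; exact h2)

theorem strip_dist_lt {z w : StripA} {r : ℝ} (h1 : |z.1 - w.1| < r) (h2 : |ht z - ht w| < r) :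
    dist z w < r := by
  rw [Prod.dist_eq]
  exact max_lt (by rwa [Real.dist_eq]) (by rw [Subtype.dist_eq, Real.dist_eq]; exact h2)

@[simp] theorem deckZ_fst (j : ℤ) (z : StripA) : (deckZ j z).1 = z.1 + j := rfl

@[simp] theorem ht_deckZ (j : ℤ) (z : StripA) : ht (deckZ j z) = ht z := rfl

@[simp] theorem deckZ_zero (z : StripA) : deckZ 0 z = z := strip_ext (by simp) rfl

theorem deckZ_deckZ (i j : ℤ) (z : StripA) : deckZ i (deckZ j z) = deckZ (i + j) z :=
  strip_ext (by simp; ring) rfl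

@[simp] theorem deckZ_neg_deckZ (j : ℤ) (z : StripA) : deckZ (-j) (deckZ j z) = z := by
  simp [deckZ_deckZ]

@[simp] theorem deckZ_deckZ_neg (j : ℤ) (z : StripA) : deckZ j (deckZ (-j) z) = z := by
  simp [deckZ_deckZ]

theorem continuous_deckZ (j : ℤ) : Continuous (deckZ j) :=
  (continuous_fst.add continuous_const).prodMk continuous_snd

theorem dist_deckZ (j : ℤ) (z w : StripA) : dist (deckZ j z) (deckZ j w) = dist z w := by
  simp [Prod.dist_eq, deckZ]

/-- The deck translation as a homeomorphism. -/
def deckH (j : ℤ) : StripA ≃ₜ StripA where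
  toFun := deckZ j
  invFun := deckZ (-j)
  left_inv := deckZ_neg_deckZ j
  right_inv := deckZ_deckZ_neg j
  continuous_toFun := continuous_deckZ j
  continuous_invFun := continuous_deckZ (-j)

/-- Invariance of a set under all deck translations. -/
def PInv (X : Set StripA) : Prop := ∀ (j : ℤ) (z : StripA), deckZ j z ∈ X ↔ z ∈ X

theorem PInv.of_imp {X : Set StripA} (h : ∀ (j : ℤ) (z : StripA), z ∈ X → deckZ j z ∈ X) :
    PInv X := fun j z => ⟨fun hz => by simpa using h (-j) _ hz, h j z⟩

theorem PInv.preimage_eq {X : Set StripA} (h : PInv X) (j : ℤ) : deckH j ⁻¹' X = X :=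
  Set.ext fun z => h j z

theorem PInv.closure {X : Set StripA} (h : PInv X) : PInv (closure X) := fun j z => by
  conv_rhs => rw [← h.preimage_eq j, ← (deckH j).preimage_closure]
  rfl

theorem PInv.interior {X : Set StripA} (h : PInv X) : PInv (interior X) := fun j z => by
  conv_rhs => rw [← h.preimage_eq j, ← (deckH j).preimage_interior]
  rfl

theorem PInv.inter {X Y : Set StripA} (hX : PInv X) (hY : PInv Y) : PInv (X ∩ Y) :=
  fun j z => and_congr (hX j z) (hY j z)

theorem PInv.union {X Y : Set StripA} (hX : PInv X) (hY : PInv Y) : PInv (X ∪ Y) :=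
  fun j z => or_congr (hX j z) (hY j z)

theorem PInv.compl {X : Set StripA} (hX : PInv X) : PInv Xᶜ :=
  fun j z => not_congr (hX j z)

theorem PInv.iInter {ι : Sort*} {X : ι → Set StripA} (hX : ∀ i, PInv (X i)) :
    PInv (⋂ i, X i) := fun j z => by
  simp only [mem_iInter]
  exact forall_congr' fun i => hX i j z

theorem PInv.ht_pred (p : ℝ → Prop) : PInv {z | p (ht z)} := fun _ _ => Iff.rfl

/-- Commutation with the deck translations. -/
def Equivariant (F : StripA ≃ₜ StripA) : Prop :=
  ∀ (j : ℤ) (z : StripA), F (deckZ j z) = deckZ j (F z)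

theorem Equivariant.symm {F : StripA ≃ₜ StripA} (h : Equivariant F) : Equivariant F.symm :=
  fun j z => by rw [Homeomorph.symm_apply_eq, h, Homeomorph.apply_symm_apply]

theorem Equivariant.iterate {F : StripA ≃ₜ StripA} (h : Equivariant F) (n j) (z : StripA) :
    F^[n] (deckZ j z) = deckZ j (F^[n] z) := by
  induction n generalizing z with
  | zero => rfl
  | succ n ih => simp only [Function.iterate_succ_apply, h j z, ih]

theorem Equivariant.image {F : StripA ≃ₜ StripA} (h : Equivariant F) {X : Set StripA}
    (hX : PInv X) : PInv (F '' X) := PInv.of_imp <| by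
  rintro j _ ⟨z, hz, rfl⟩
  exact ⟨deckZ j z, (hX j z).2 hz, h j z⟩

theorem Equivariant.preimage {F : StripA ≃ₜ StripA} (h : Equivariant F) {X : Set StripA}
    (hX : PInv X) : PInv (F ⁻¹' X) := fun j z => by
  rw [mem_preimage, h, hX, mem_preimage]

/-- Every open set returns to itself, modulo deck translations, at arbitrarily large times. -/
def Recurrent (F : StripA ≃ₜ StripA) : Prop :=
  ∀ U : Set StripA, IsOpen U → U.Nonempty → ∀ N : ℕ, ∃ k ≥ N, ∃ w ∈ U, ∃ j : ℤ,
    deckZ j (F^[k] w) ∈ U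

theorem iterate_symm_iterate (F : StripA ≃ₜ StripA) (k : ℕ) (z : StripA) :
    F.symm^[k] (F^[k] z) = z :=
  (Function.LeftInverse.iterate F.symm_apply_apply k) z

theorem iterate_iterate_symm (F : StripA ≃ₜ StripA) (k : ℕ) (z : StripA) :
    F^[k] (F.symm^[k] z) = z :=
  (Function.LeftInverse.iterate F.apply_symm_apply k) z

theorem Recurrent.symm {F : StripA ≃ₜ StripA} (he : Equivariant F) (h : Recurrent F) :
    Recurrent F.symm := by
  intro U hU hne N
  obtain ⟨k, hk, w, hw, j, hj⟩ := h U hU hne N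
  refine ⟨k, hk, _, hj, -j, ?_⟩
  rwa [he.symm.iterate, iterate_symm_iterate, deckZ_neg_deckZ]

/-- A forward invariant open set has invariant closure, by recurrence. -/
theorem image_closure_eq {F : StripA ≃ₜ StripA} (he : Equivariant F) (hr : Recurrent F)
    {O : Set StripA} (ho : IsOpen O) (hp : PInv O) (hF : ∀ z ∈ O, F z ∈ O) :
    F '' closure O = closure O := by
  apply Subset.antisymm
  · rw [F.image_closure]
    exact closure_mono (image_subset_iff.2 hF)
  · have hcl : IsClosed (F '' closure O) := F.isClosedMap _ isClosed_closure
    refine closure_minimal (fun z hz => ?_) hcl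
    by_contra hzn
    obtain ⟨k, hk, w, hw, j, hj⟩ := hr (O \ F '' closure O) (ho.sdiff hcl) ⟨z, hz, hzn⟩ 1
    obtain ⟨k, rfl⟩ : ∃ m, k = m + 1 := ⟨k - 1, by omega⟩
    have hO : ∀ n, F^[n] w ∈ O := fun n => by
      induction n with
      | zero => exact hw.1
      | succ n ih => rw [Function.iterate_succ_apply']; exact hF _ ih
    refine hj.2 ?_
    rw [Function.iterate_succ_apply', ← he]
    exact mem_image_of_mem _ (subset_closure ((hp j _).2 (hO k)))

/-- A fundamental domain of the strip. -/
def box : Set StripA := Set.Icc (0 : ℝ) 1 ×ˢ univ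

theorem isCompact_box : IsCompact box := isCompact_Icc.prod isCompact_univ

theorem exists_deckZ_mem_box (z : StripA) : ∃ j : ℤ, deckZ j z ∈ box := by
  refine ⟨-⌊z.1⌋, ⟨?_, ?_⟩, trivial⟩ <;> simp only [deckZ_fst, Int.cast_neg]
  · linarith [Int.floor_le z.1]
  · linarith [Int.lt_floor_add_one z.1]

theorem PInv.nonempty_iInter {Q : ℕ → Set StripA} (hp : ∀ n, PInv (Q n))
    (hc : ∀ n, IsClosed (Q n)) (ha : ∀ n, Q (n + 1) ⊆ Q n) (hne : ∀ n, (Q n).Nonempty) :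
    (⋂ n, Q n).Nonempty := by
  obtain ⟨z, hz⟩ := IsCompact.nonempty_iInter_of_sequence_nonempty_isCompact_isClosed
    (fun n => Q n ∩ box) (fun n => inter_subset_inter_left _ (ha n))
    (fun n => by
      obtain ⟨z, hz⟩ := hne n
      obtain ⟨j, hj⟩ := exists_deckZ_mem_box z
      exact ⟨_, (hp n j z).2 hz, hj⟩)
    (isCompact_box.inter_left (hc 0)) (fun n => (hc n).inter isCompact_box.isClosed)
  exact ⟨z, mem_iInter.2 fun n => (mem_iInter.1 hz n).1⟩

/-- A deck invariant closed set on which a deck invariant continuous function is positive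
everywhere: the function is bounded below by a positive constant. -/
theorem PInv.exists_pos_le {X : Set StripA} (hp : PInv X) (hc : IsClosed X) {g : StripA → ℝ}
    (hg : Continuous g) (hgp : ∀ j z, g (deckZ j z) = g z) (hpos : ∀ z ∈ X, 0 < g z) :
    ∃ b > 0, ∀ z ∈ X, b ≤ g z := by
  have hK : IsCompact (X ∩ box) := isCompact_box.inter_left hc
  rcases (X ∩ box).eq_empty_or_nonempty with h | h
  · refine ⟨1, one_pos, fun z hz => ?_⟩
    obtain ⟨j, hj⟩ := exists_deckZ_mem_box z
    exact absurd ⟨(hp j z).2 hz, hj⟩ (eq_empty_iff_forall_notMem.1 h (deckZ j z))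
  · obtain ⟨z₀, hz₀, hmin⟩ := hK.exists_isMinOn h hg.continuousOn
    refine ⟨g z₀, hpos _ hz₀.1, fun z hz => ?_⟩
    obtain ⟨j, hj⟩ := exists_deckZ_mem_box z
    rw [← hgp j z]
    exact hmin ⟨(hp j z).2 hz, hj⟩

theorem Equivariant.exists_uniform {F : StripA ≃ₜ StripA} (h : Equivariant F) {ε : ℝ}
    (hε : 0 < ε) : ∃ δ > 0, ∀ z w, dist z w < δ → dist (F z) (F w) < ε := by
  have hK : IsCompact (Set.Icc (-1 : ℝ) 2 ×ˢ (univ : Set (Set.Icc (0:ℝ) 1))) :=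
    isCompact_Icc.prod isCompact_univ
  have hu := hK.uniformContinuousOn_of_continuous F.continuous.continuousOn
  obtain ⟨δ, hδ, H⟩ := Metric.uniformContinuousOn_iff.1 hu ε hε
  refine ⟨min δ 1, by positivity, fun z w hzw => ?_⟩
  obtain ⟨j, hj⟩ := exists_deckZ_mem_box z
  have h1 : |(deckZ j z).1 - (deckZ j w).1| < 1 := by
    refine (fst_lipschitz _ _).trans_lt ?_
    rw [dist_deckZ]
    exact hzw.trans_le (min_le_right _ _)
  rw [← dist_deckZ j, ← h, ← h]
  rw [abs_lt] at h1
  refine H _ ⟨⟨by linarith [hj.1.1], by linarith [hj.1.2]⟩, trivial⟩ _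
    ⟨⟨by linarith [hj.1.1], by linarith [hj.1.2]⟩, trivial⟩ ?_
  rw [dist_deckZ]
  exact hzw.trans_le (min_le_left _ _)

/-- The lift of a recurrent positive twist homeomorphism of the annulus without invariant graph
other than the boundary. -/
structure StripTwist where
  F : StripA ≃ₜ StripA
  equi : Equivariant F
  bot : ∀ z, ht (F z) = 0 ↔ ht z = 0
  top : ∀ z, ht (F z) = 1 ↔ ht z = 1
  twist : ∀ z w : StripA, z.1 = w.1 → ht z < ht w → (F z).1 < (F w).1
  symm_twist : ∀ z w : StripA, z.1 = w.1 → ht z < ht w → (F.symm w).1 < (F.symm z).1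
  recur : Recurrent F
  graph : ∀ φ : ℝ → ℝ, Continuous φ → (∀ x, φ (x + 1) = φ x) → (∀ x, φ x ∈ Icc (0:ℝ) 1) →
    (∀ z, ht z = φ z.1 ↔ ht (F z) = φ (F z).1) → (∀ x, φ x = 0) ∨ (∀ x, φ x = 1)

/-- The reflection of the strip exchanging the boundary lines. -/
def refl : StripA ≃ₜ StripA := (Homeomorph.refl ℝ).prodCongr unitInterval.symmHomeomorph

/-- The half turn of the strip. -/
noncomputable def halfTurn : StripA ≃ₜ StripA :=
  (Homeomorph.neg ℝ).prodCongr unitInterval.symmHomeomorph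

@[simp] theorem refl_fst (z : StripA) : (refl z).1 = z.1 := rfl
@[simp] theorem ht_refl (z : StripA) : ht (refl z) = 1 - ht z := rfl
@[simp] theorem halfTurn_fst (z : StripA) : (halfTurn z).1 = -z.1 := rfl
@[simp] theorem ht_halfTurn (z : StripA) : ht (halfTurn z) = 1 - ht z := rfl
@[simp] theorem refl_refl (z : StripA) : refl (refl z) = z := strip_ext rfl (by simp)
@[simp] theorem halfTurn_halfTurn (z : StripA) : halfTurn (halfTurn z) = z :=
  strip_ext (by simp) (by simp)

theorem refl_deckZ (j : ℤ) (z : StripA) : refl (deckZ j z) = deckZ j (refl z) := rfl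
theorem halfTurn_deckZ (j : ℤ) (z : StripA) : halfTurn (deckZ j z) = deckZ (-j) (halfTurn z) :=
  strip_ext (by simp; ring) rfl

theorem iterate_conj {R F : StripA ≃ₜ StripA} (hR : ∀ z, R (R z) = z) (k : ℕ) (z : StripA) :
    (R.trans (F.trans R))^[k] z = R (F^[k] (R z)) := by
  induction k generalizing z with
  | zero => simp [hR]
  | succ k ih => rw [Function.iterate_succ_apply, ih]; simp [hR]

theorem Recurrent.conj {R F : StripA ≃ₜ StripA} (hR : ∀ z, R (R z) = z)
    (hd : ∀ j z, ∃ i, deckZ i (R z) = R (deckZ j z)) (h : Recurrent F) :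
    Recurrent (R.trans (F.trans R)) := by
  intro U hU ⟨u, hu⟩ N
  obtain ⟨k, hk, w, hw, j, hj⟩ := h (R ⁻¹' U) (hU.preimage R.continuous)
    ⟨R u, by simpa [hR] using hu⟩ N
  obtain ⟨i, hi⟩ := hd j (F^[k] w)
  exact ⟨k, hk, R w, hw, i, by rw [iterate_conj hR, hR, hi]; exact hj⟩

namespace StripTwist

variable (f : StripTwist)

theorem bot_symm (z) : ht (f.F.symm z) = 0 ↔ ht z = 0 := by
  rw [← f.bot, Homeomorph.apply_symm_apply]

theorem top_symm (z) : ht (f.F.symm z) = 1 ↔ ht z = 1 := by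
  rw [← f.top, Homeomorph.apply_symm_apply]

theorem ht_pos {z} (hz : 0 < ht z) : 0 < ht (f.F z) :=
  (ht_nonneg _).lt_of_ne fun h => hz.ne' ((f.bot z).1 h.symm)

theorem symm_ht_pos {z} (hz : 0 < ht z) : 0 < ht (f.F.symm z) :=
  (ht_nonneg _).lt_of_ne fun h => hz.ne' ((f.bot_symm z).1 h.symm)

/-- The inverse map seen upside down. -/
def flip : StripTwist where
  F := refl.trans (f.F.symm.trans refl)
  equi j z := by simp [refl_deckZ, f.equi.symm j]
  bot z := by
    have := f.top_symm (refl z)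
    simp only [Homeomorph.trans_apply, ht_refl] at this ⊢
    constructor <;> intro h
    · linarith [this.1 (by linarith)]
    · linarith [this.2 (by linarith)]
  top z := by
    have := f.bot_symm (refl z)
    simp only [Homeomorph.trans_apply, ht_refl] at this ⊢
    constructor <;> intro h
    · linarith [this.1 (by linarith)]
    · linarith [this.2 (by linarith)]
  twist z w h1 h2 := f.symm_twist (refl w) (refl z) h1.symm (by simpa using h2)
  symm_twist z w h1 h2 := by
    have := f.twist (refl w) (refl z) h1.symm (by simpa using h2)
    have e : ∀ u, (refl.trans (f.F.symm.trans refl)).symm u = refl (f.F (refl u)) := fun u => by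
      rw [Homeomorph.symm_apply_eq]; simp
    rw [e, e]
    exact this
  recur := (f.recur.symm f.equi).conj refl_refl fun j z => ⟨j, rfl⟩
  graph φ hc hp h01 hi := by
    have := f.graph (fun x => 1 - φ x) (by fun_prop) (fun x => by simp [hp])
      (fun x => ⟨by linarith [(h01 x).2], by linarith [(h01 x).1]⟩) (fun z => by
        have := hi (refl (f.F z))
        simp only [Homeomorph.trans_apply, refl_refl, Homeomorph.symm_apply_apply, ht_refl,
          refl_fst] at this
        constructor <;> intro h
        · linarith [this.2 (by linarith)]
        · linarith [this.1 (by linarith)])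
    rcases this with h | h
    · exact Or.inr fun x => by linarith [h x]
    · exact Or.inl fun x => by linarith [h x]

@[simp] theorem flip_apply (z) : f.flip.F z = refl (f.F.symm (refl z)) := rfl

/-- The conjugate of the map by the half turn. -/
noncomputable def turn : StripTwist where
  F := halfTurn.trans (f.F.trans halfTurn)
  equi j z := by simp [halfTurn_deckZ, f.equi _]
  bot z := by
    have := f.top (halfTurn z)
    simp only [Homeomorph.trans_apply, ht_halfTurn] at this ⊢
    constructor <;> intro h
    · linarith [this.1 (by linarith)]
    · linarith [this.2 (by linarith)]
  top z := by
    have := f.bot (halfTurn z)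
    simp only [Homeomorph.trans_apply, ht_halfTurn] at this ⊢
    constructor <;> intro h
    · linarith [this.1 (by linarith)]
    · linarith [this.2 (by linarith)]
  twist z w h1 h2 := by
    have := f.twist (halfTurn w) (halfTurn z) (by simp [h1]) (by simpa using h2)
    simpa using this
  symm_twist z w h1 h2 := by
    have := f.symm_twist (halfTurn w) (halfTurn z) (by simp [h1]) (by simpa using h2)
    have e : ∀ u, (halfTurn.trans (f.F.trans halfTurn)).symm u = halfTurn (f.F.symm (halfTurn u)) :=
      fun u => by rw [Homeomorph.symm_apply_eq]; simp
    rw [e, e]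
    simpa using this
  recur := f.recur.conj halfTurn_halfTurn fun j z => ⟨-j, (halfTurn_deckZ j z).symm⟩
  graph φ hc hp h01 hi := by
    have := f.graph (fun x => 1 - φ (-x)) (by fun_prop)
      (fun x => by rw [← hp (-(x + 1))]; congr 2; ring)
      (fun x => ⟨by linarith [(h01 (-x)).2], by linarith [(h01 (-x)).1]⟩) (fun z => by
        have := hi (halfTurn z)
        simp only [Homeomorph.trans_apply, halfTurn_halfTurn, ht_halfTurn,
          halfTurn_fst] at this
        constructor <;> intro h
        · linarith [this.1 (by linarith)]
        · linarith [this.2 (by linarith)])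
    rcases this with h | h
    · exact Or.inr fun x => by simpa using (sub_eq_zero.1 (h (-x))).symm
    · exact Or.inl fun x => by simpa using h (-x)

end StripTwist

/-- A set containing every point below any of its points. -/
def DownClosed (D : Set StripA) : Prop := ∀ z w : StripA, z.1 = w.1 → ht w ≤ ht z → z ∈ D → w ∈ D

theorem le_ht_pt {x y c : ℝ} (hc : c ≤ 1) (h : c ≤ y) : c ≤ ht (pt x y) :=
  le_max_of_le_right (le_min hc h)

theorem ht_pt_le {x y c : ℝ} (hc : 0 ≤ c) (h : y ≤ c) : ht (pt x y) ≤ c :=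
  max_le hc ((min_le_right _ _).trans h)

theorem continuous_shift (h : ℝ) : Continuous fun u : StripA => pt u.1 (ht u + h) :=
  continuous_pt.comp (continuous_fst.prodMk (continuous_ht.add continuous_const))

theorem continuous_pt_right (x : ℝ) : Continuous (pt x) :=
  continuous_pt.comp (continuous_const.prodMk continuous_id)

theorem continuous_pt_left (y : ℝ) : Continuous fun x => pt x y :=
  continuous_pt.comp (continuous_id.prodMk continuous_const)

theorem DownClosed.interior {D : Set StripA} (h : DownClosed D) : DownClosed (interior D) := by
  intro z w h1 h2 hz
  refine mem_interior.2 ⟨(fun u => pt u.1 (ht u + (ht z - ht w))) ⁻¹' _root_.interior D,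
    fun u hu => ?_,
    isOpen_interior.preimage (continuous_shift _), ?_⟩
  · exact h (pt u.1 (ht u + (ht z - ht w))) u rfl (le_ht_pt (ht_le_one u) (by linarith))
      (interior_subset hu)
  · have : pt w.1 (ht w + (ht z - ht w)) = z := by rw [add_sub_cancel, ← h1, pt_ht]
    rwa [mem_preimage, this]

theorem DownClosed.closure {D : Set StripA} (h : DownClosed D) : DownClosed (closure D) := by
  intro z w h1 h2 hz
  have := map_mem_closure (t := D) (continuous_shift (ht w - ht z)) hz
    fun u hu => h u _ rfl (ht_pt_le (ht_nonneg u) (by linarith)) hu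
  have e : pt z.1 (ht z + (ht w - ht z)) = w := by rw [add_sub_cancel, h1, pt_ht]
  rwa [e] at this

/-- A curve in a down closed set forces the region below its lowest point into the set. -/
theorem DownClosed.mem_of_curve {D : Set StripA} (h : DownClosed D) {a b m : ℝ} {c : ℝ → StripA}
    (hab : a ≤ b) (hc : ContinuousOn c (Icc a b)) (hD : ∀ t ∈ Icc a b, c t ∈ D)
    (hm : ∀ t ∈ Icc a b, m ≤ ht (c t)) {w : StripA} (hw : w.1 ∈ uIcc (c a).1 (c b).1)
    (hwm : ht w ≤ m) : w ∈ D := by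
  rw [← uIcc_of_le hab] at hc hD hm
  obtain ⟨t, ht', e⟩ := intermediate_value_uIcc (f := fun t => (c t).1)
    (continuous_fst.comp_continuousOn hc) hw
  exact h _ _ e (hwm.trans (hm t ht')) (hD t ht')

namespace StripTwist

variable (f : StripTwist)

theorem exists_interior {D : Set StripA} (h : DownClosed D) (hF : ∀ z ∈ D, f.F z ∈ D)
    {z₀ : StripA} (hz₀ : z₀ ∈ D) (h0 : 0 < ht z₀) : ∃ z ∈ interior D, 0 < ht z := by
  set c : ℝ → StripA := fun t => f.F (pt z₀.1 t) with hcdef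
  have hc : Continuous c := f.F.continuous.comp (continuous_pt_right _)
  have hle : ht z₀ / 2 ≤ ht z₀ := by linarith
  have h1 := ht_le_one z₀
  obtain ⟨t₀, ht₀, hmin⟩ := isCompact_Icc.exists_isMinOn (nonempty_Icc.2 hle)
    (continuous_ht.comp hc).continuousOn
  have hm : 0 < ht (c t₀) := f.ht_pos (by
    rw [ht_pt (by linarith [ht₀.1]) (by linarith [ht₀.2])]; linarith [ht₀.1])
  have hx : (c (ht z₀ / 2)).1 < (c (ht z₀)).1 := f.twist _ _ rfl (by
    rw [ht_pt (by linarith) (by linarith), ht_pt (by linarith) (by linarith)]; linarith)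
  have hsub : {w : StripA | (c (ht z₀ / 2)).1 < w.1 ∧ w.1 < (c (ht z₀)).1 ∧ ht w < ht (c t₀)} ⊆
      D := by
    rintro w ⟨w1, w2, w3⟩
    refine h.mem_of_curve hle hc.continuousOn (fun t ht' => hF _ ?_) (fun t ht' => hmin ht')
      (Icc_subset_uIcc ⟨w1.le, w2.le⟩) w3.le
    exact h z₀ _ rfl (by rw [ht_pt (by linarith [ht'.1]) (by linarith [ht'.2])]; exact ht'.2) hz₀
  have hopen : IsOpen {w : StripA |
      (c (ht z₀ / 2)).1 < w.1 ∧ w.1 < (c (ht z₀)).1 ∧ ht w < ht (c t₀)} :=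
    (isOpen_lt continuous_const continuous_fst).inter
      ((isOpen_lt continuous_fst continuous_const).inter (isOpen_lt continuous_ht continuous_const))
  have hh : ht (pt (((c (ht z₀ / 2)).1 + (c (ht z₀)).1) / 2) (ht (c t₀) / 2)) = ht (c t₀) / 2 :=
    ht_pt (by linarith) (by linarith [ht_le_one (c t₀)])
  refine ⟨_, interior_maximal hsub hopen (a := pt (((c (ht z₀ / 2)).1 + (c (ht z₀)).1) / 2)
    (ht (c t₀) / 2)) ⟨?_, ?_, ?_⟩, ?_⟩
  · rw [pt_fst]; linarith
  · rw [pt_fst]; linarith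
  · rw [hh]; linarith
  · rw [hh]; linarith

end StripTwist

theorem DownClosed.exists_function {E : Set StripA} (h : DownClosed E) (hc : IsClosed E)
    (hb : ∀ z, ht z = 0 → z ∈ E) :
    ∃ φ : ℝ → ℝ, (∀ x, φ x ∈ Icc (0:ℝ) 1) ∧ ∀ z, z ∈ E ↔ ht z ≤ φ z.1 := by
  have : ∀ x : ℝ, ∃ y ∈ Icc (0:ℝ) 1, ∀ z : StripA, z.1 = x → (z ∈ E ↔ ht z ≤ y) := by
    intro x
    have hK : IsCompact (Icc (0:ℝ) 1 ∩ pt x ⁻¹' E) :=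
      isCompact_Icc.inter_right (hc.preimage (continuous_pt_right x))
    obtain ⟨y, hy, hmax⟩ := hK.exists_isMaxOn (f := id)
      ⟨0, ⟨le_rfl, zero_le_one⟩, hb _ (ht_pt le_rfl zero_le_one)⟩ continuousOn_id
    refine ⟨y, hy.1, fun z hz => ⟨fun hE => ?_, fun hle => ?_⟩⟩
    · refine hmax (a := ht z) ⟨⟨ht_nonneg z, ht_le_one z⟩, ?_⟩
      rwa [mem_preimage, ← hz, pt_ht]
    · exact h (pt x y) z hz.symm (by rwa [ht_pt hy.1.1 hy.1.2]) hy.2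
  choose φ h1 h2 using this
  exact ⟨φ, h1, fun z => h2 z.1 z rfl⟩

/-- One-sided lower semicontinuity of the upper boundary of a down closed set containing the
image of a vertical segment. -/
theorem DownClosed.eventually_one_side {E : Set StripA} (h : DownClosed E) {H : StripA ≃ₜ StripA}
    {q : StripA} (hq : 0 < ht q) (hH : ∀ w : StripA, w.1 = q.1 → ht w ≤ ht q → H w ∈ E) {a : ℝ}
    (ha : a < ht (H q)) : ∃ w : StripA, w.1 = q.1 ∧ ht w < ht q ∧
      ∀ u : StripA, u.1 ∈ uIcc (H w).1 (H q).1 → ht u ≤ a → u ∈ E := by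
  set c : ℝ → StripA := fun t => H (pt q.1 t)
  have hc : Continuous c := H.continuous.comp (continuous_pt_right _)
  have hev : ∀ᶠ t in 𝓝 (ht q), a < ht (c t) :=
    (continuous_ht.comp hc).continuousAt.eventually_const_lt (by simpa [c] using ha)
  obtain ⟨l, hl, hlt⟩ := exists_Ioc_subset_of_mem_nhds hev ⟨0, hq⟩
  set t₁ := (max l 0 + ht q) / 2
  have hmax : max l 0 < ht q := max_lt hl hq
  have h0 : 0 ≤ max l 0 := le_max_right _ _
  have hl' : l ≤ max l 0 := le_max_left _ _
  have h1 := ht_le_one q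
  have e1 : ht (pt q.1 t₁) = t₁ := ht_pt (by simp only [t₁]; linarith) (by simp only [t₁]; linarith)
  refine ⟨pt q.1 t₁, rfl, by rw [e1]; simp only [t₁]; linarith, fun u hu hua => ?_⟩
  refine h.mem_of_curve (a := t₁) (b := ht q) (m := a) (c := c) (by simp only [t₁]; linarith)
    hc.continuousOn (fun t ht' => hH _ rfl ?_) (fun t ht' => (hlt ⟨?_, ht'.2⟩).le) ?_ hua
  · have : 0 ≤ t := by have := ht'.1; simp only [t₁] at this; linarith
    rw [ht_pt this (ht'.2.trans h1)]; exact ht'.2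
  · have := ht'.1; simp only [t₁] at this; linarith
  · simpa [c] using hu

/-- Invariance of the upper boundary of a down closed set. -/
theorem ht_eq_of_invariant {E : Set StripA} {φ : ℝ → ℝ} (hφ : Continuous φ)
    (hφ1 : ∀ x, φ x ∈ Icc (0:ℝ) 1)
    (hE : ∀ z, z ∈ E ↔ ht z ≤ φ z.1) {H : StripA ≃ₜ StripA} (hH : ∀ z, H z ∈ E ↔ z ∈ E)
    (htop : ∀ z, ht (H z) = 1 ↔ ht z = 1) {z : StripA} (hz : ht z = φ z.1) :
    ht (H z) = φ (H z).1 := by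
  refine le_antisymm ((hE _).1 ((hH z).2 ((hE z).2 hz.le))) (not_lt.1 fun hlt => ?_)
  have hz1 : ht z < 1 := (ht_le_one z).lt_of_ne fun h => by
    have := (htop z).2 h
    linarith [(hφ1 (H z).1).2]
  have hev : ∀ᶠ t in 𝓝 (ht z), ht (H (pt z.1 t)) < φ (H (pt z.1 t)).1 := by
    have hcont : Continuous fun t => H (pt z.1 t) := H.continuous.comp (continuous_pt_right _)
    refine ((isOpen_lt (continuous_ht.comp hcont)
      (hφ.comp (continuous_fst.comp hcont))).mem_nhds ?_)
    simpa using hlt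
  obtain ⟨t, ht1, ht2⟩ := (hev.filter_mono nhdsWithin_le_nhds).and
    (Ioc_mem_nhdsGT hz1) |>.exists
  have h3 := (hE _).1 ((hH _).1 ((hE _).2 ht1.le))
  rw [ht_pt ((ht_nonneg z).trans ht2.1.le) ht2.2, pt_fst, ← hz] at h3
  exact absurd ht2.1 (not_lt.2 h3)

namespace StripTwist

variable (f : StripTwist)

theorem continuous_upper_boundary {E : Set StripA} (h : DownClosed E) (hc : IsClosed E)
    (hF : ∀ z, f.F z ∈ E ↔ z ∈ E) {φ : ℝ → ℝ} (hφ1 : ∀ x, φ x ∈ Icc (0:ℝ) 1)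
    (hE : ∀ z, z ∈ E ↔ ht z ≤ φ z.1) : Continuous φ := by
  refine continuous_iff_continuousAt.2 fun x₀ => tendsto_order.2 ⟨fun a ha => ?_, fun a ha => ?_⟩
  · rcases lt_or_ge a 0 with h0 | h0
    · exact Eventually.of_forall fun x => h0.trans_le (hφ1 x).1
    obtain ⟨b, hab, hb⟩ := exists_between ha
    have hb1 : b ≤ 1 := hb.le.trans (hφ1 x₀).2
    set p := pt x₀ (φ x₀)
    have hp : ht p = φ x₀ := ht_pt (hφ1 x₀).1 (hφ1 x₀).2
    have hp0 : 0 < ht p := by rw [hp]; linarith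
    have hpE : p ∈ E := (hE p).2 hp.le
    have key : ∀ x, pt x b ∈ E → a < φ x := fun x hx => by
      have := (hE _).1 hx
      rw [ht_pt (h0.trans hab.le) hb1, pt_fst] at this
      linarith
    have hF' : ∀ z, f.F.symm z ∈ E ↔ z ∈ E := fun z => by rw [← hF, Homeomorph.apply_symm_apply]
    obtain ⟨w, w1, w2, w3⟩ := h.eventually_one_side (H := f.F) (q := f.F.symm p)
      (f.symm_ht_pos hp0) (fun w e1 e2 => (hF w).2 (h _ _ e1.symm e2 ((hF' p).2 hpE)))
      (a := b) (by rw [Homeomorph.apply_symm_apply, hp]; exact hb)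
    obtain ⟨v, v1, v2, v3⟩ := h.eventually_one_side (H := f.F.symm) (q := f.F p)
      (f.ht_pos hp0) (fun w e1 e2 => (hF' w).2 (h _ _ e1.symm e2 ((hF p).2 hpE)))
      (a := b) (by rw [Homeomorph.symm_apply_apply, hp]; exact hb)
    have hw := f.twist _ _ w1 w2
    have hv := f.symm_twist _ _ v1 v2
    rw [Homeomorph.apply_symm_apply] at w3 hw
    rw [Homeomorph.symm_apply_apply] at v3 hv
    filter_upwards [Ioo_mem_nhds hw hv] with x hx
    refine key x ?_
    rcases le_total x x₀ with hxx | hxx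
    · exact w3 _ (Icc_subset_uIcc ⟨hx.1.le, hxx⟩) (ht_pt (h0.trans hab.le) hb1).le
    · exact v3 _ (Icc_subset_uIcc' ⟨hxx, hx.2.le⟩) (ht_pt (h0.trans hab.le) hb1).le
  · rcases lt_or_ge 1 a with h1 | h1
    · exact Eventually.of_forall fun x => (hφ1 x).2.trans_lt h1
    have h0 : 0 ≤ a := (hφ1 x₀).1.trans ha.le
    have : ∀ᶠ x in 𝓝 x₀, pt x a ∈ Eᶜ := (continuous_pt_left a).continuousAt.eventually_mem
      (hc.isOpen_compl.mem_nhds fun hm => by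
        have := (hE _).1 hm
        rw [ht_pt h0 h1, pt_fst] at this
        linarith)
    filter_upwards [this] with x hx
    by_contra hcon
    exact hx ((hE _).2 (by rw [ht_pt h0 h1]; exact not_lt.1 hcon))

/-- There is no nontrivial deck invariant, backward invariant set which is closed under moving
upwards and misses the bottom line. -/
theorem no_invariant_upset {X : Set StripA} (hp : PInv X)
    (hup : ∀ z w : StripA, z.1 = w.1 → ht z ≤ ht w → z ∈ X → w ∈ X) (hbot : ∀ z ∈ X, 0 < ht z)
    (hF : ∀ z, f.F z ∈ X → z ∈ X) {w₀ : StripA} (hw₀ : w₀ ∈ X) (hw1 : ht w₀ < 1) {z₀ : StripA}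
    (hz₀ : z₀ ∉ X) (hz0 : 0 < ht z₀) : False := by
  have hD : DownClosed Xᶜ := fun z w h1 h2 hz hw => hz (hup w z h1.symm h2 hw)
  obtain ⟨d, hd, hd0⟩ := f.exists_interior hD (fun z hz hz' => hz (hF z hz')) hz₀ hz0
  obtain ⟨u, hu, -⟩ := f.flip.exists_interior (D := refl ⁻¹' X)
    (fun z w h1 h2 hz => hup (refl z) (refl w) h1 (by simp only [ht_refl]; linarith) hz)
    (fun z hz => by
      refine hF _ ?_
      simpa using hz) (z₀ := refl w₀) (by simpa using hw₀) (by simpa using hw1)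
  have hu' : refl u ∈ interior X := by
    rw [← refl.preimage_interior] at hu
    exact hu
  have hDop : PInv (interior Xᶜ) := hp.compl.interior
  have hcl := image_closure_eq f.equi f.recur isOpen_interior hDop fun z hz => by
    have : f.F '' interior Xᶜ ⊆ Xᶜ := by
      rintro _ ⟨v, hv, rfl⟩ hv'
      exact interior_subset hv (hF v hv')
    exact interior_maximal this (f.F.isOpenMap _ isOpen_interior) (mem_image_of_mem _ hz)
  set E : Set StripA := closure (interior Xᶜ) ∪ {z | ht z = 0}
  have hE : DownClosed E := by
    rintro z w h1 h2 (hz | hz)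
    · exact Or.inl (hD.interior.closure z w h1 h2 hz)
    · exact Or.inr (le_antisymm (h2.trans hz.le) (ht_nonneg w))
  have hEc : IsClosed E := isClosed_closure.union (isClosed_eq continuous_ht continuous_const)
  have hEp : PInv E := hDop.closure.union (PInv.ht_pred (· = 0))
  have hEF : ∀ z, f.F z ∈ E ↔ z ∈ E := fun z => by
    refine or_congr ?_ (f.bot z)
    conv_lhs => rw [← hcl]
    exact f.F.injective.mem_set_image
  obtain ⟨φ, hφ1, hφ⟩ := hE.exists_function hEc fun z hz => Or.inr hz
  have hcont := f.continuous_upper_boundary hE hEc hEF hφ1 hφ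
  have hper : ∀ x, φ (x + 1) = φ x := by
    have : ∀ x (j : ℤ), φ x ≤ φ (x + j) := fun x j => by
      have h1 : pt x (φ x) ∈ E := (hφ _).2 (ht_pt (hφ1 x).1 (hφ1 x).2).le
      have := (hφ _).1 ((hEp j _).2 h1)
      rwa [ht_deckZ, ht_pt (hφ1 x).1 (hφ1 x).2] at this
    intro x
    apply le_antisymm
    · simpa using this (x + 1) (-1)
    · simpa using this x 1
  have hinv : ∀ z, ht z = φ z.1 ↔ ht (f.F z) = φ (f.F z).1 := fun z => by
    refine ⟨ht_eq_of_invariant hcont hφ1 hφ hEF f.top, fun h => ?_⟩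
    have := ht_eq_of_invariant hcont hφ1 hφ (H := f.F.symm)
      (fun z => by rw [← hEF, Homeomorph.apply_symm_apply]) f.top_symm h
    rwa [Homeomorph.symm_apply_apply] at this
  rcases f.graph φ hcont hper hφ1 hinv with h | h
  · have := (hφ d).1 (Or.inl (subset_closure hd))
    rw [h] at this
    linarith
  · have hE1 : refl u ∈ E := (hφ _).2 (by rw [h]; exact ht_le_one _)
    rcases hE1 with h1 | h1
    · obtain ⟨v, hv1, hv2⟩ := mem_closure_iff.1 h1 _ isOpen_interior hu'
      exact interior_subset hv2 (interior_subset hv1)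
    · exact (hbot _ (interior_subset hu')).ne' h1

end StripTwist

/-- The affine segment between two points of the strip. -/
def seg (p q : StripA) : Set StripA :=
  (fun t : ℝ => pt ((1 - t) * p.1 + t * q.1) ((1 - t) * ht p + t * ht q)) '' Icc 0 1

theorem continuous_segment_param (p q : StripA) : Continuous
    fun t : ℝ => pt ((1 - t) * p.1 + t * q.1) ((1 - t) * ht p + t * ht q) :=
  continuous_pt.comp (f := fun t : ℝ => ((1 - t) * p.1 + t * q.1, (1 - t) * ht p + t * ht q))
    (by fun_prop)

theorem isCompact_seg (p q : StripA) : IsCompact (seg p q) :=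
  isCompact_Icc.image (continuous_segment_param p q)

theorem isPreconnected_seg (p q : StripA) : IsPreconnected (seg p q) :=
  isPreconnected_Icc.image _ (continuous_segment_param p q).continuousOn

theorem left_mem_seg (p q : StripA) : p ∈ seg p q := ⟨0, by simp, by simp⟩

theorem right_mem_seg (p q : StripA) : q ∈ seg p q := ⟨1, by simp, by simp⟩

theorem exists_of_mem_seg {p q u : StripA} (hu : u ∈ seg p q) : ∃ t ∈ Icc (0:ℝ) 1,
    u.1 = (1 - t) * p.1 + t * q.1 ∧ ht u = (1 - t) * ht p + t * ht q := by
  obtain ⟨t, ht', rfl⟩ := hu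
  refine ⟨t, ht', rfl, ht_pt ?_ ?_⟩
  · nlinarith [ht_nonneg p, ht_nonneg q, ht'.1, ht'.2, mul_nonneg ht'.1 (ht_nonneg q),
      mul_nonneg (sub_nonneg.2 ht'.2) (ht_nonneg p)]
  · nlinarith [ht_le_one p, ht_le_one q, ht'.1, ht'.2,
      mul_le_mul_of_nonneg_left (ht_le_one q) ht'.1,
      mul_le_mul_of_nonneg_left (ht_le_one p) (sub_nonneg.2 ht'.2)]

theorem dist_le_of_mem_seg {p q u : StripA} (hu : u ∈ seg p q) : dist u p ≤ dist p q := by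
  obtain ⟨t, ht', h1, h2⟩ := exists_of_mem_seg hu
  have key : ∀ a b : ℝ, |a - b| ≤ dist p q → |(1 - t) * a + t * b - a| ≤ dist p q := by
    intro a b hab
    rw [show (1 - t) * a + t * b - a = t * (b - a) by ring, abs_mul, abs_of_nonneg ht'.1,
      abs_sub_comm]
    exact (mul_le_of_le_one_left (abs_nonneg _) ht'.2).trans hab
  exact strip_dist_le (h1 ▸ key _ _ (fst_lipschitz p q)) (h2 ▸ key _ _ (ht_lipschitz p q))

theorem le_ht_of_mem_seg {p q u : StripA} {m : ℝ} (hu : u ∈ seg p q) (hp : m ≤ ht p)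
    (hq : m ≤ ht q) : m ≤ ht u := by
  obtain ⟨t, ht', -, h2⟩ := exists_of_mem_seg hu
  rw [h2]
  nlinarith [mul_le_mul_of_nonneg_left hq ht'.1,
    mul_le_mul_of_nonneg_left hp (sub_nonneg.2 ht'.2)]

theorem lt_ht_of_mem_seg {p q u : StripA} {m : ℝ} (hu : u ∈ seg p q) (hp : m < ht p)
    (hq : m < ht q) : m < ht u :=
  (lt_min hp hq).trans_le (le_ht_of_mem_seg hu (min_le_left _ _) (min_le_right _ _))

/-- The points joined to `A` by a continuum contained in `U`. -/
def Reach (A U : Set StripA) : Set StripA :=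
  {w | ∃ C, IsCompact C ∧ IsPreconnected C ∧ C ⊆ U ∧ w ∈ C ∧ (C ∩ A).Nonempty}

namespace Reach

variable {A U : Set StripA}

theorem subset : Reach A U ⊆ U := fun _ ⟨_, _, _, h, hw, _⟩ => h hw

theorem of_mem {w : StripA} (hA : w ∈ A) (hU : w ∈ U) : w ∈ Reach A U :=
  ⟨{w}, isCompact_singleton, isPreconnected_singleton, singleton_subset_iff.2 hU, rfl, w, rfl, hA⟩

theorem mono {U' : Set StripA} (h : U ⊆ U') : Reach A U ⊆ Reach A U' :=
  fun _ ⟨C, h1, h2, h3, h4⟩ => ⟨C, h1, h2, h3.trans h, h4⟩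

theorem extend {C : Set StripA} {u : StripA} (hu : u ∈ Reach A U) (huC : u ∈ C)
    (hc : IsCompact C) (hp : IsPreconnected C) (hC : C ⊆ U) : C ⊆ Reach A U := by
  obtain ⟨D, h1, h2, h3, h4, h5⟩ := hu
  exact fun w hw => ⟨C ∪ D, hc.union h1, hp.union u huC h4 h2, union_subset hC h3, Or.inl hw,
    h5.mono (inter_subset_inter_left _ subset_union_right)⟩

theorem exists_continuum {w : StripA} (hw : w ∈ Reach A U) : ∃ C, IsCompact C ∧
    IsPreconnected C ∧ C ⊆ Reach A U ∧ w ∈ C ∧ (C ∩ A).Nonempty := by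
  obtain ⟨C, h1, h2, h3, h4, h5⟩ := hw
  exact ⟨C, h1, h2, fun v hv => ⟨C, h1, h2, h3, hv, h5⟩, h4, h5⟩

theorem isOpen (hU : IsOpen U) : IsOpen (Reach A U) := by
  refine Metric.isOpen_iff.2 fun w hw => ?_
  obtain ⟨ε, hε, h⟩ := Metric.isOpen_iff.1 hU w (subset hw)
  refine ⟨ε, hε, fun u hu => extend hw (left_mem_seg w u) (isCompact_seg w u)
    (isPreconnected_seg w u) (fun v hv => h ?_) (right_mem_seg w u)⟩
  exact (dist_le_of_mem_seg hv).trans_lt (by rwa [dist_comm])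

theorem map (H : StripA ≃ₜ StripA) {A' U' : Set StripA} (hA : ∀ z ∈ A, H z ∈ A')
    (hU : ∀ z ∈ U, H z ∈ U') {w : StripA} (hw : w ∈ Reach A U) : H w ∈ Reach A' U' := by
  obtain ⟨C, h1, h2, h3, h4, u, h5, h6⟩ := hw
  exact ⟨H '' C, h1.image H.continuous, h2.image _ H.continuous.continuousOn,
    image_subset_iff.2 fun z hz => hU z (h3 hz), mem_image_of_mem _ h4, H u,
    mem_image_of_mem _ h5, hA u h6⟩

theorem pinv (hA : PInv A) (hU : PInv U) : PInv (Reach A U) :=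
  PInv.of_imp fun j _ hz => map (deckH j) (fun z => (hA j z).2) (fun z => (hU j z).2) hz

theorem isPreconnected (hA : IsPreconnected A) (hAU : A ⊆ U) : IsPreconnected (Reach A U) := by
  rcases A.eq_empty_or_nonempty with rfl | ⟨a, ha⟩
  · have : Reach ∅ U = ∅ := eq_empty_iff_forall_notMem.2 fun w ⟨C, _, _, _, _, _, _, h⟩ => h
    rw [this]
    exact isPreconnected_empty
  refine isPreconnected_of_forall a fun w hw => ?_
  obtain ⟨C, h1, h2, h3, h4, h5⟩ := exists_continuum hw
  obtain ⟨u, hu1, hu2⟩ := h5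
  exact ⟨C ∪ A, union_subset h3 fun z hz => of_mem hz (hAU hz), Or.inr ha, Or.inl h4,
    h2.union u hu1 hu2 hA⟩

end Reach

theorem isPreconnected_level {c : ℝ} (h0 : 0 ≤ c) (h1 : c ≤ 1) :
    IsPreconnected {z : StripA | ht z = c} := by
  have : {z : StripA | ht z = c} = range fun x => pt x c := by
    ext z
    constructor
    · rintro rfl
      exact ⟨z.1, pt_ht z⟩
    · rintro ⟨x, rfl⟩
      exact ht_pt h0 h1
  rw [this]
  exact isPreconnected_range (continuous_pt_left c)

/-- `p` and `q` are points of `K` at distance less than `ε`. -/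
def Near (K : Set StripA) (ε : ℝ) (p q : StripA) : Prop := p ∈ K ∧ q ∈ K ∧ dist p q < ε

/-- Every point of `K` is joined inside `K` to `A` by chains of arbitrarily small mesh. -/
def Chained (A K : Set StripA) : Prop :=
  ∀ ε > 0, ∀ z ∈ K, ∃ p ∈ A, Relation.ReflTransGen (Near K ε) p z

/-- A closed deck invariant set attached to the bottom line and missing the top line. -/
structure Good (K : Set StripA) : Prop where
  closed : IsClosed K
  pinv : PInv K
  bot : ∀ z, ht z = 0 → z ∈ K
  lt_one : ∀ z ∈ K, ht z < 1
  chain : Chained {z | ht z = 0} K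

theorem Chained.map {A K : Set StripA} (h : Chained A K) {H : StripA ≃ₜ StripA}
    (he : Equivariant H) (hA : ∀ z ∈ A, H z ∈ A) : Chained A (H '' K) := by
  rintro ε hε _ ⟨z, hz, rfl⟩
  obtain ⟨δ, hδ, hu⟩ := he.exists_uniform hε
  obtain ⟨p, hp, hc⟩ := h δ hδ z hz
  exact ⟨H p, hA p hp, hc.lift H fun a b hab =>
    ⟨mem_image_of_mem _ hab.1, mem_image_of_mem _ hab.2.1, hu _ _ hab.2.2⟩⟩

theorem Good.map {K : Set StripA} (h : Good K) {H : StripA ≃ₜ StripA} (he : Equivariant H)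
    (hb : ∀ z, ht (H z) = 0 ↔ ht z = 0) (htop : ∀ z, ht (H z) = 1 ↔ ht z = 1) :
    Good (H '' K) where
  closed := H.isClosedMap _ h.closed
  pinv := he.image h.pinv
  bot z hz := ⟨H.symm z, h.bot _ ((hb _).1 (by rwa [H.apply_symm_apply])), H.apply_symm_apply z⟩
  lt_one := by
    rintro _ ⟨z, hz, rfl⟩
    exact (ht_le_one _).lt_of_ne fun e => (h.lt_one z hz).ne ((htop z).1 e)
  chain := h.chain.map he fun z => (hb z).2

theorem Good.exists_le {K : Set StripA} (h : Good K) : ∃ a < 1, ∀ z ∈ K, ht z ≤ a := by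
  obtain ⟨b, hb, H⟩ := h.pinv.exists_pos_le h.closed (g := fun z => 1 - ht z)
    (continuous_const.sub continuous_ht) (fun j z => rfl) fun z hz => sub_pos.2 (h.lt_one z hz)
  exact ⟨1 - b, by linarith, fun z hz => by linarith [H z hz]⟩

/-- The part of the complement of `K` attached to the top line. -/
def Above (K : Set StripA) : Set StripA := Reach {z | ht z = 1} Kᶜ

namespace Good

variable {K : Set StripA} (h : Good K)
include h

theorem isOpen_above : IsOpen (Above K) := Reach.isOpen h.closed.isOpen_compl

theorem pinv_above : PInv (Above K) := Reach.pinv (PInv.ht_pred (· = 1)) h.pinv.compl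

theorem top_mem_above {z : StripA} (hz : ht z = 1) : z ∈ Above K :=
  Reach.of_mem hz fun hK => (h.lt_one z hK).ne hz

theorem isPreconnected_above : IsPreconnected (Above K) :=
  Reach.isPreconnected (isPreconnected_level zero_le_one le_rfl)
    fun z hz hK => (h.lt_one z hK).ne hz

end Good

theorem notMem_above {K : Set StripA} {z : StripA} (hz : z ∈ K) : z ∉ Above K :=
  fun hV => Reach.subset hV hz

theorem above_image {K : Set StripA} {H : StripA ≃ₜ StripA}
    (htop : ∀ z, ht (H z) = 1 ↔ ht z = 1) : Above (H '' K) = H '' Above K := by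
  ext w
  constructor
  · intro hw
    refine ⟨H.symm w, Reach.map (U := (H '' K)ᶜ) (U' := Kᶜ) H.symm (fun z hz => (htop _).1 ?_)
      (fun z hz hK => hz ⟨_, hK, H.apply_symm_apply z⟩) hw, H.apply_symm_apply w⟩
    rw [H.apply_symm_apply]
    exact hz
  · rintro ⟨v, hv, rfl⟩
    refine Reach.map H (fun z hz => (htop z).2 hz) (fun z hz => ?_) hv
    rintro ⟨u, hu, e⟩
    exact hz (H.injective e ▸ hu)

/-- `α` is a continuous determination on `V` of the angle from the upward vertical to the vector
from `z` to the given point, with values in `(-π/2, π/2)` on the top line. -/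
structure IsAngle (V : Set StripA) (z : StripA) (α : StripA → ℝ) : Prop where
  cont : ContinuousOn α V
  polar : ∀ w ∈ V, ∃ r > 0, ht w - ht z = r * Real.cos (α w) ∧ w.1 - z.1 = -(r * Real.sin (α w))
  top : ∀ w ∈ V, ht w = 1 → |α w| < Real.pi / 2

namespace IsAngle

variable {V : Set StripA} {z : StripA} {α : StripA → ℝ}

theorem mono (h : IsAngle V z α) {V' : Set StripA} (hV : V' ⊆ V) : IsAngle V' z α :=
  ⟨h.cont.mono hV, fun w hw => h.polar w (hV hw), fun w hw => h.top w (hV hw)⟩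

theorem deck (h : IsAngle V z α) (hV : PInv V) (j : ℤ) :
    IsAngle V (deckZ j z) fun w => α (deckZ (-j) w) where
  cont := h.cont.comp (continuous_deckZ _).continuousOn fun w hw => (hV _ w).2 hw
  polar w hw := by
    obtain ⟨r, hr, h1, h2⟩ := h.polar _ ((hV (-j) w).2 hw)
    refine ⟨r, hr, h1, ?_⟩
    rw [← h2]
    simp only [deckZ_fst]
    push_cast
    ring
  top w hw hw1 := h.top _ ((hV (-j) w).2 hw) hw1

theorem eqOn {V₁ V₂ : Set StripA} {β : StripA → ℝ} (h₁ : IsAngle V₁ z α) (h₂ : IsAngle V₂ z β)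
    {C : Set StripA} (hC : IsPreconnected C) (hC₁ : C ⊆ V₁) (hC₂ : C ⊆ V₂) {t : StripA}
    (htC : t ∈ C) (ht1 : ht t = 1) {w : StripA} (hw : w ∈ C) : α w = β w := by
  have hcos : ∀ u ∈ C, Real.cos (α u - β u) = 1 := fun u hu => by
    obtain ⟨r, hr, a1, a2⟩ := h₁.polar u (hC₁ hu)
    obtain ⟨s, hs, b1, b2⟩ := h₂.polar u (hC₂ hu)
    have e1 : r * Real.cos (α u) = s * Real.cos (β u) := by rw [← a1, ← b1]
    have e2 : r * Real.sin (α u) = s * Real.sin (β u) := by linarith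
    have e3 : r = s := by
      have : r ^ 2 = s ^ 2 := by
        calc r ^ 2 = (r * Real.cos (α u)) ^ 2 + (r * Real.sin (α u)) ^ 2 := by
              rw [mul_pow, mul_pow, ← mul_add, Real.cos_sq_add_sin_sq, mul_one]
          _ = s ^ 2 := by
              rw [e1, e2, mul_pow, mul_pow, ← mul_add, Real.cos_sq_add_sin_sq, mul_one]
      exact (pow_left_inj₀ hr.le hs.le two_ne_zero).1 this
    subst e3
    rw [Real.cos_sub, mul_left_cancel₀ hr.ne' e1, mul_left_cancel₀ hr.ne' e2, ← sq, ← sq,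
      Real.cos_sq_add_sin_sq]
  have hcont : ContinuousOn (fun u => |α u - β u|) C :=
    ((h₁.cont.mono hC₁).sub (h₂.cont.mono hC₂)).abs
  have hlt : |α w - β w| < Real.pi := by
    by_contra hcon
    have h0 : |α t - β t| < Real.pi := by
      refine (abs_sub _ _).trans_lt ?_
      linarith [h₁.top t (hC₁ htC) ht1, h₂.top t (hC₂ htC) ht1]
    obtain ⟨u, hu, e⟩ := hC.intermediate_value htC hw hcont ⟨h0.le, not_lt.1 hcon⟩
    have := hcos u hu
    have e' : |α u - β u| = Real.pi := e
    rw [← Real.cos_abs, e', Real.cos_pi] at this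
    norm_num at this
  rw [abs_lt] at hlt
  have := (Real.cos_eq_one_iff_of_lt_of_lt (by linarith [Real.pi_pos])
    (by linarith [Real.pi_pos])).1
    (hcos w hw)
  linarith

theorem abs_lt_of_above (h : IsAngle V z α) {C : Set StripA} (hC : IsPreconnected C) (hCV : C ⊆ V)
    {t : StripA} (htC : t ∈ C) (ht1 : ht t = 1) (hz : ∀ u ∈ C, ht z < ht u)
    {w : StripA} (hw : w ∈ C) : |α w| < Real.pi / 2 := by
  by_contra hcon
  obtain ⟨u, hu, e⟩ := hC.intermediate_value htC hw (h.cont.mono hCV).abs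
    ⟨(h.top t (hCV htC) ht1).le, not_lt.1 hcon⟩
  obtain ⟨r, -, h1, -⟩ := h.polar u (hCV hu)
  have e' : |α u| = Real.pi / 2 := e
  rw [← Real.cos_abs, e', Real.cos_pi_div_two] at h1
  linarith [hz u hu]

theorem sin_eq_zero_iff (h : IsAngle V z α) {w : StripA} (hw : w ∈ V) :
    Real.sin (α w) = 0 ↔ w.1 = z.1 := by
  obtain ⟨r, hr, -, h2⟩ := h.polar w hw
  constructor <;> intro e
  · rw [e] at h2; linarith
  · have : r * Real.sin (α w) = 0 := by linarith
    exact (mul_eq_zero.1 this).resolve_left hr.ne'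

/-- Along a vertical segment the angle does not cross a multiple of `π`. -/
theorem lt_of_vertical (h : IsAngle V z α) {C : Set StripA} (hC : IsPreconnected C) (hCV : C ⊆ V)
    {x : ℝ} (hx : ∀ u ∈ C, u.1 = x) {k : ℤ} {w w' : StripA} (hw : w ∈ C) (hw' : w' ∈ C)
    (hk : k * Real.pi < α w) : k * Real.pi < α w' := by
  by_contra hcon
  rw [not_lt] at hcon
  have hiv : ∀ v, α w' ≤ v → v ≤ α w → ∃ u ∈ C, α u = v := fun v h1 h2 =>
    hC.intermediate_value hw' hw (h.cont.mono hCV) ⟨h1, h2⟩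
  obtain ⟨u, hu, e⟩ := hiv _ hcon hk.le
  have hxz : x = z.1 := by
    rw [← hx u hu, ← h.sin_eq_zero_iff (hCV hu), e, Real.sin_int_mul_pi]
  set s := min (α w - k * Real.pi) (Real.pi / 2)
  have hs : 0 < s := lt_min (by linarith) (by linarith [Real.pi_pos])
  obtain ⟨v, hv, e⟩ := hiv (k * Real.pi + s) (by linarith)
    (by linarith [min_le_left (α w - k * Real.pi) (Real.pi / 2)])
  have h0 := (h.sin_eq_zero_iff (hCV hv)).2 ((hx v hv).trans hxz)
  rw [e, add_comm, Real.sin_add_int_mul_pi] at h0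
  have hsin : 0 < Real.sin s := Real.sin_pos_of_pos_of_lt_pi hs
    ((min_le_right _ _).trans_lt (by linarith [Real.pi_pos]))
  rcases mul_eq_zero.1 h0 with h0 | h0
  · exact (zpow_ne_zero k (by norm_num)) h0
  · exact hsin.ne' h0

end IsAngle

/-- The vector from `z` to `w`, rotated so that the upward vertical becomes the positive real
axis. -/
noncomputable def vec (z w : StripA) : ℂ := ⟨ht w - ht z, -(w.1 - z.1)⟩

theorem dist_le_norm_vec (z w : StripA) : dist w z ≤ ‖vec z w‖ := by
  refine strip_dist_le ?_ (Complex.abs_re_le_norm (vec z w))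
  simpa [vec, abs_sub_comm] using Complex.abs_im_le_norm (vec z w)

theorem norm_vec_sub_le (z z' w : StripA) : ‖vec z' w - vec z w‖ ≤ 2 * dist z z' := by
  refine (Complex.norm_le_abs_re_add_abs_im _).trans ?_
  have h1 := fst_lipschitz z z'
  have h2 := ht_lipschitz z z'
  have e1 : (vec z' w - vec z w).re = ht z - ht z' := by simp [vec]
  have e2 : (vec z' w - vec z w).im = -(z.1 - z'.1) := by simp [vec]
  rw [e1, e2, abs_neg]
  linarith

theorem continuous_vec (z : StripA) : Continuous (vec z) := by
  have : vec z = fun w => ((ht w - ht z : ℝ) : ℂ) + ((-(w.1 - z.1) : ℝ) : ℂ) * Complex.I := by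
    ext w
    apply Complex.ext <;> simp [vec]
  rw [this]
  have := continuous_ht
  fun_prop

/-- Construction of an angle from a polar form of the rotated vector. -/
theorem isAngle_of_polar {V : Set StripA} {z : StripA} {α : StripA → ℝ} (hc : ContinuousOn α V)
    (hne : ∀ w ∈ V, vec z w ≠ 0)
    (h : ∀ w ∈ V, vec z w = ‖vec z w‖ * Complex.exp (α w * Complex.I))
    (htop : ∀ w ∈ V, ht w = 1 → |α w| < Real.pi / 2) : IsAngle V z α where
  cont := hc
  polar w hw := by
    refine ⟨‖vec z w‖, norm_pos_iff.2 (hne w hw), ?_, ?_⟩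
    · have := congrArg Complex.re (h w hw)
      simpa [vec, Complex.exp_re] using this
    · have := congrArg Complex.im (h w hw)
      rw [Complex.im_ofReal_mul, Complex.exp_ofReal_mul_I_im] at this
      have e : (vec z w).im = -(w.1 - z.1) := rfl
      linarith
  top := htop

theorem IsAngle.vec_eq {V : Set StripA} {z : StripA} {α : StripA → ℝ} (h : IsAngle V z α)
    {w : StripA} (hw : w ∈ V) :
    vec z w = ‖vec z w‖ * Complex.exp (α w * Complex.I) := by
  obtain ⟨r, hr, h1, h2⟩ := h.polar w hw
  have e : vec z w = r * Complex.exp (α w * Complex.I) := by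
    apply Complex.ext
    · simp [vec, Complex.exp_re, h1]
    · simp [vec, Complex.exp_im]; linarith
  have : ‖vec z w‖ = r := by
    rw [e, norm_mul, Complex.norm_exp_ofReal_mul_I, mul_one, Complex.norm_real,
      Real.norm_of_nonneg hr.le]
  rw [this, e]

/-- The points at distance at least `δ` from `K`. -/
def Far (K : Set StripA) (δ : ℝ) : Set StripA := {w | ∀ z ∈ K, δ ≤ dist w z}

namespace Good

variable {K : Set StripA} (h : Good K)
include h

theorem exists_angle_far {δ : ℝ} (hδ : 0 < δ) {z : StripA} (hz : z ∈ K) :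
    ∃ α, IsAngle (Far K δ) z α := by
  obtain ⟨p, hp, hchain⟩ := h.chain (δ / 2) (by positivity) z hz
  have hne : ∀ z ∈ K, ∀ w ∈ Far K δ, vec z w ≠ 0 := fun z hz w hw =>
    norm_pos_iff.1 (hδ.trans_le ((hw z hz).trans (dist_le_norm_vec z w)))
  clear hz
  induction hchain with
  | refl =>
    have hre : ∀ w ∈ Far K δ, 0 < (vec p w).re := fun w hw => by
      have h1 := hw (pt w.1 0) (h.bot _ (ht_pt le_rfl zero_le_one))
      have h2 : dist w (pt w.1 0) ≤ ht w := by
        refine strip_dist_le (by simpa using ht_nonneg w) ?_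
        rw [ht_pt le_rfl zero_le_one, sub_zero, abs_of_nonneg (ht_nonneg w)]
      have : (vec p w).re = ht w - ht p := rfl
      rw [this, show ht p = 0 from hp]
      linarith
    refine ⟨fun w => (vec p w).arg, isAngle_of_polar (fun w hw => ?_)
      (hne p (h.bot p hp)) (fun w _ => (Complex.norm_mul_exp_arg_mul_I _).symm) fun w hw _ =>
        Complex.abs_arg_lt_pi_div_two_iff.2 (Or.inl (hre w hw))⟩
    exact ((Complex.continuousAt_arg (Or.inl (hre w hw))).comp
      (continuous_vec p).continuousAt).continuousWithinAt
  | @tail z z' _ hstep ih =>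
    obtain ⟨α, hα⟩ := ih
    obtain ⟨hzK, hzK', hd⟩ := hstep
    have hre : ∀ w ∈ Far K δ, 0 < (vec z' w / vec z w).re := fun w hw => by
      have hpos : 0 < ‖vec z w‖ := norm_pos_iff.2 (hne z hzK w hw)
      have h1 : ‖vec z' w / vec z w - 1‖ < 1 := by
        rw [div_sub_one (hne z hzK w hw), norm_div, div_lt_one hpos]
        linarith [norm_vec_sub_le z z' w, hw z hzK, dist_le_norm_vec z w]
      have h2 := (abs_lt.1 ((Complex.abs_re_le_norm _).trans_lt h1)).1
      simp only [Complex.sub_re, Complex.one_re] at h2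
      linarith
    have hpolar : ∀ w ∈ Far K δ, vec z' w = ‖vec z' w‖ *
        Complex.exp ((α w + (vec z' w / vec z w).arg : ℝ) * Complex.I) := fun w hw => by
      have e1 : vec z' w = vec z w * (vec z' w / vec z w) :=
        (mul_div_cancel₀ _ (hne z hzK w hw)).symm
      have e2 : ‖vec z' w‖ = ‖vec z w‖ * ‖vec z' w / vec z w‖ := by rw [← norm_mul, ← e1]
      have e3 := Complex.norm_mul_exp_arg_mul_I (vec z' w / vec z w)
      have e4 := hα.vec_eq hw
      calc vec z' w = ‖vec z w‖ * Complex.exp (α w * Complex.I) * (‖vec z' w / vec z w‖ *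
              Complex.exp ((vec z' w / vec z w).arg * Complex.I)) := by rw [e3, ← e4, ← e1]
        _ = _ := by
          rw [e2]
          push_cast
          rw [add_mul, Complex.exp_add]
          ring
    refine ⟨_, isAngle_of_polar (α := fun w => α w + (vec z' w / vec z w).arg) (fun w hw => ?_)
      (hne z' hzK') hpolar fun w hw hw1 => ?_⟩
    · refine (hα.cont w hw).add (ContinuousAt.continuousWithinAt ?_)
      exact (Complex.continuousAt_arg (Or.inl (hre w hw))).comp (f := fun w => vec z' w / vec z w)
        ((continuous_vec z').continuousAt.div (continuous_vec z).continuousAt (hne z hzK w hw))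
    · have h1 := hα.top w hw hw1
      have h2 := Complex.abs_arg_lt_pi_div_two_iff.2 (Or.inl (hre w hw))
      have h3 := congrArg Complex.re (hpolar w hw)
      have h4 : (vec z' w).re = ht w - ht z' := rfl
      rw [h4, hw1, Complex.re_ofReal_mul, Complex.exp_ofReal_mul_I_re] at h3
      have h5 := h.lt_one z' hzK'
      by_contra hcon
      rw [← Real.cos_abs] at h3
      have h6 := Real.cos_nonpos_of_pi_div_two_le_of_le (not_lt.1 hcon)
        ((abs_add_le _ _).trans (by linarith [Real.pi_pos]))
      nlinarith [norm_nonneg (vec z' w)]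

theorem exists_angle {z : StripA} (hz : z ∈ K) : ∃ α, IsAngle (Above K) z α := by
  let P : StripA → ℝ → Prop := fun w θ => ∃ δ > 0, ∃ C, IsPreconnected C ∧ C ⊆ Far K δ ∧ w ∈ C ∧
    (∃ t ∈ C, ht t = 1) ∧ ∃ α, IsAngle (Far K δ) z α ∧ α w = θ
  have hmono : ∀ {δ δ' : ℝ}, δ ≤ δ' → Far K δ' ⊆ Far K δ := fun hle w hw u hu =>
    hle.trans (hw u hu)
  have hfar : ∀ C, IsCompact C → C ⊆ Kᶜ → ∃ δ > 0, C ⊆ Far K δ := fun C hC hCK => by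
    obtain ⟨δ, hδ, H⟩ := hC.exists_thickening_subset_open h.closed.isOpen_compl hCK
    refine ⟨δ, hδ, fun w hw u hu => ?_⟩
    by_contra hcon
    exact H (Metric.mem_thickening_iff.2 ⟨w, hw, by rw [dist_comm]; exact not_le.1 hcon⟩) hu
  have huniq : ∀ w θ θ', P w θ → P w θ' → θ = θ' := by
    rintro w θ θ' ⟨δ, hδ, C, hC, hCF, hwC, ⟨t, htC, ht1⟩, α, hα, rfl⟩
      ⟨δ', hδ', C', hC', hCF', hwC', ⟨t', htC', ht1'⟩, α', hα', rfl⟩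
    obtain ⟨β, hβ⟩ := h.exists_angle_far (lt_min hδ hδ') hz
    rw [hα.eqOn hβ hC hCF (hCF.trans (hmono (min_le_left _ _))) htC ht1 hwC,
      hα'.eqOn hβ hC' hCF' (hCF'.trans (hmono (min_le_right _ _))) htC' ht1' hwC']
  have hex : ∀ w ∈ Above K, ∃ δ > 0, ∃ C, IsPreconnected C ∧ C ⊆ Far K δ ∧ w ∈ C ∧
      ∃ t ∈ C, ht t = 1 := by
    rintro w ⟨C, h1, h2, h3, h4, t, h5, h6⟩
    obtain ⟨δ, hδ, H⟩ := hfar C h1 h3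
    exact ⟨δ, hδ, C, h2, H, h4, t, h5, h6⟩
  have hloc : ∀ w ∈ Above K, ∃ δ > 0, ∃ α, IsAngle (Far K δ) z α ∧ Metric.ball w δ ⊆ Far K δ ∧
      ∀ u ∈ Metric.ball w δ, P u (α u) := by
    intro w hw
    obtain ⟨δ, hδ, C, hC, hCF, hwC, t, htC, ht1⟩ := hex w hw
    obtain ⟨α, hα⟩ := h.exists_angle_far (half_pos hδ) hz
    have hball : ∀ u, dist u w < δ / 2 → u ∈ Far K (δ / 2) := fun u hu v hv => by
      have h1 := hCF hwC v hv
      have h2 := dist_triangle w u v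
      rw [dist_comm w u] at h2
      linarith
    refine ⟨δ / 2, half_pos hδ, α, hα, hball, fun u hu => ?_⟩
    refine ⟨δ / 2, half_pos hδ, C ∪ seg w u, hC.union w hwC (left_mem_seg w u)
      (isPreconnected_seg w u), union_subset (hCF.trans (hmono (by linarith))) fun v hv =>
        hball v ((dist_le_of_mem_seg hv).trans_lt ?_), Or.inr (right_mem_seg w u),
      ⟨t, Or.inl htC, ht1⟩, α, hα, rfl⟩
    rwa [dist_comm]
  choose! α hα using fun w (hw : w ∈ Above K) => (show ∃ θ, P w θ by
    obtain ⟨δ, hδ, α, -, -, H⟩ := hloc w hw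
    exact ⟨α w, H w (Metric.mem_ball_self hδ)⟩)
  refine ⟨α, fun w hw => ?_, fun w hw => ?_, fun w hw hw1 => ?_⟩
  · obtain ⟨δ, hδ, β, hβ, hball, H⟩ := hloc w hw
    have hnhds : Metric.ball w δ ∩ Above K ∈ 𝓝 w :=
      inter_mem (Metric.ball_mem_nhds w hδ) (h.isOpen_above.mem_nhds hw)
    refine ContinuousAt.continuousWithinAt (ContinuousAt.congr (f := β) ?_ ?_)
    · exact (hβ.cont.mono hball).continuousAt (Metric.ball_mem_nhds w hδ)
    · filter_upwards [hnhds] with u hu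
      exact huniq u _ _ (H u hu.1) (hα u hu.2)
  · obtain ⟨δ, hδ, C, hC, hCF, hwC, -, β, hβ, e⟩ := hα w hw
    rw [← e]
    exact hβ.polar w (hCF hwC)
  · obtain ⟨δ, hδ, C, hC, hCF, hwC, -, β, hβ, e⟩ := hα w hw
    rw [← e]
    exact hβ.top w (hCF hwC) hw1

end Good

theorem neg_one_zpow_eq (n : ℤ) : (-1 : ℝ) ^ n = 1 ∨ (-1 : ℝ) ^ n = -1 :=
  (Int.even_or_odd n).imp Even.neg_one_zpow Odd.neg_one_zpow

theorem IsAngle.vertical {V : Set StripA} {z : StripA} {α : StripA → ℝ} (h : IsAngle V z α)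
    {w : StripA} (hw : w ∈ V) {n : ℤ} (hn : α w = n * Real.pi) :
    z.1 = w.1 ∧ 0 < (-1) ^ n * (ht w - ht z) := by
  refine ⟨((h.sin_eq_zero_iff hw).1 (by rw [hn, Real.sin_int_mul_pi])).symm, ?_⟩
  obtain ⟨r, hr, h1, -⟩ := h.polar w hw
  rw [h1, hn, Real.cos_int_mul_pi]
  rcases neg_one_zpow_eq n with e | e <;> rw [e] <;> linarith

theorem IsAngle.sin_sub {V : Set StripA} {z : StripA} {α : StripA → ℝ} (h : IsAngle V z α)
    {w : StripA} (hw : w ∈ V) (n : ℤ) :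
    ∃ r > 0, (-1) ^ n * (w.1 - z.1) = -(r * Real.sin (α w - n * Real.pi)) := by
  obtain ⟨r, hr, -, h2⟩ := h.polar w hw
  exact ⟨r, hr, by rw [h2, Real.sin_sub_int_mul_pi]; ring⟩

namespace StripTwist

variable (f : StripTwist)

theorem sin_neg_of_vertical {V V' : Set StripA} {z : StripA} {α α' : StripA → ℝ}
    (hα : IsAngle V z α) (hα' : IsAngle V' (f.F z) α') {w : StripA} (hw : w ∈ V)
    (hw' : f.F w ∈ V') {n : ℤ} (hn : α w = n * Real.pi) :
    Real.sin (α' (f.F w) - n * Real.pi) < 0 := by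
  obtain ⟨h1, h2⟩ := hα.vertical hw hn
  obtain ⟨r, hr, h3⟩ := hα'.sin_sub hw' n
  have h4 : 0 < (-1) ^ n * ((f.F w).1 - (f.F z).1) := by
    rcases neg_one_zpow_eq n with e | e <;> rw [e] at h2 ⊢
    · linarith [f.twist z w h1 (by linarith)]
    · linarith [f.twist w z h1.symm (by linarith)]
  by_contra hcon
  nlinarith [mul_nonneg hr.le (not_lt.1 hcon)]

theorem sin_pos_of_vertical {V V' : Set StripA} {z : StripA} {α α' : StripA → ℝ}
    (hα : IsAngle V z α) (hα' : IsAngle V' (f.F z) α') {w : StripA} (hw : w ∈ V)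
    (hw' : f.F w ∈ V') {n : ℤ} (hn : α' (f.F w) = n * Real.pi) :
    0 < Real.sin (α w - n * Real.pi) := by
  obtain ⟨h1, h2⟩ := hα'.vertical hw' hn
  obtain ⟨r, hr, h3⟩ := hα.sin_sub hw n
  have h4 : (-1) ^ n * (w.1 - z.1) < 0 := by
    rcases neg_one_zpow_eq n with e | e <;> rw [e] at h2 ⊢
    · have := f.symm_twist _ _ h1 (by linarith)
      simp only [Homeomorph.symm_apply_apply] at this
      linarith
    · have := f.symm_twist _ _ h1.symm (by linarith)
      simp only [Homeomorph.symm_apply_apply] at this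
      linarith
  by_contra hcon
  nlinarith [mul_nonneg hr.le (neg_nonneg.2 (not_lt.1 hcon))]

/-- A positive twist map tilts vectors to the right: the angle cannot cross a multiple of `π`
upwards. -/
theorem angle_step {V V' : Set StripA} (hVo : IsOpen V) (hV : IsPreconnected V)
    (hVt : ∀ w, ht w = 1 → w ∈ V) {z : StripA} {α α' : StripA → ℝ}
    (hα : IsAngle V z α) (hVV' : ∀ w ∈ V, f.F w ∈ V') (hα' : IsAngle V' (f.F z) α') {k : ℤ}
    {w : StripA} (hw : w ∈ V) (hk : α w ≤ k * Real.pi) : α' (f.F w) < k * Real.pi := by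
  have hpi := Real.pi_pos
  have hc' : ContinuousOn (fun w => α' (f.F w)) V :=
    hα'.cont.comp f.F.continuous.continuousOn hVV'
  set S : Set StripA := ⋃ k : ℤ, V ∩ {w | (k - 1) * Real.pi < α w} ∩
    (V ∩ {w | α' (f.F w) < k * Real.pi})
  set B : Set StripA := ⋃ k : ℤ, V ∩ {w | α w < k * Real.pi} ∩
    (V ∩ {w | k * Real.pi < α' (f.F w)})
  have hSo : IsOpen S := isOpen_iUnion fun k =>
    (hα.cont.isOpen_inter_preimage hVo isOpen_Ioi).inter
      (hc'.isOpen_inter_preimage hVo isOpen_Iio)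
  have hBo : IsOpen B := isOpen_iUnion fun k =>
    (hα.cont.isOpen_inter_preimage hVo isOpen_Iio).inter
      (hc'.isOpen_inter_preimage hVo isOpen_Ioi)
  have hcover : V ⊆ S ∪ B := fun u hu => by
    set n := ⌈α u / Real.pi⌉
    have h1 : α u ≤ n * Real.pi := (div_le_iff₀ hpi).1 (Int.le_ceil _)
    have h2 : (n - 1) * Real.pi < α u := (lt_div_iff₀ hpi).1
      (by linarith [Int.ceil_lt_add_one (α u / Real.pi)])
    rcases lt_trichotomy (α' (f.F u)) (n * Real.pi) with h3 | h3 | h3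
    · exact Or.inl (mem_iUnion.2 ⟨n, ⟨hu, h2⟩, hu, h3⟩)
    · have h4 := f.sin_pos_of_vertical hα hα' hu (hVV' u hu) h3
      have h5 := Real.sin_nonpos_of_nonpos_of_neg_pi_le (x := α u - n * Real.pi) (by linarith)
        (by linarith)
      linarith
    · right
      rcases h1.lt_or_eq with h1 | h1
      · exact mem_iUnion.2 ⟨n, ⟨hu, h1⟩, hu, h3⟩
      · have h4 := f.sin_neg_of_vertical hα hα' hu (hVV' u hu) h1
        refine mem_iUnion.2 ⟨n + 1, ⟨hu, ?_⟩, hu, ?_⟩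
        · show α u < _
          push_cast; linarith
        · show _ < α' (f.F u)
          push_cast
          by_contra hcon
          have := Real.sin_nonneg_of_nonneg_of_le_pi (x := α' (f.F u) - n * Real.pi)
            (by linarith) (by linarith)
          linarith
  have hdisj : Disjoint S B := by
    rw [Set.disjoint_left]
    intro u hS hB
    obtain ⟨k, ⟨-, h1⟩, -, h2⟩ := mem_iUnion.1 hS
    obtain ⟨l, ⟨-, h3⟩, -, h4⟩ := mem_iUnion.1 hB
    have h5 : ((k - 1 : ℤ) : ℝ) < l := by
      push_cast
      exact lt_of_mul_lt_mul_right (lt_trans h1 h3) hpi.le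
    have h6 : (l : ℝ) < k := lt_of_mul_lt_mul_right (lt_trans h4 h2) hpi.le
    have h5' : k - 1 < l := by exact_mod_cast h5
    have h6' : l < k := by exact_mod_cast h6
    omega
  have htop : (V ∩ S).Nonempty := by
    have e1 : ht (pt z.1 1) = 1 := ht_pt zero_le_one le_rfl
    have hu : pt z.1 1 ∈ V := hVt _ e1
    have h1 := abs_lt.1 (hα.top _ hu e1)
    have h0 : α (pt z.1 1) = 0 := by
      have hs := (hα.sin_eq_zero_iff hu).2 rfl
      exact (Real.sin_eq_zero_iff_of_lt_of_lt (by linarith) (by linarith)).1 hs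
    have h2 := f.sin_neg_of_vertical hα hα' hu (hVV' _ hu) (n := 0) (by simpa using h0)
    have h3 := abs_lt.1 (hα'.top _ (hVV' _ hu) ((f.top _).2 e1))
    simp only [Int.cast_zero, zero_mul, sub_zero] at h2
    refine ⟨_, hu, mem_iUnion.2 ⟨0, ⟨hu, ?_⟩, hu, ?_⟩⟩
    · show _ < α _
      rw [h0]; push_cast; linarith
    · show α' _ < _
      by_contra hcon
      push_cast at hcon
      have := Real.sin_nonneg_of_nonneg_of_le_pi (x := α' (f.F (pt z.1 1)))
            (by linarith) (by linarith)
      linarith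
  obtain ⟨l, ⟨-, h1⟩, -, h2⟩ := mem_iUnion.1
    (hV.subset_left_of_subset_union hSo hBo hdisj hcover htop hw)
  have h3 : ((l - 1 : ℤ) : ℝ) < k := by
    push_cast
    exact lt_of_mul_lt_mul_right (h1.trans_le hk) hpi.le
  have h4 : l - 1 < k := by exact_mod_cast h3
  have h5 : (l : ℝ) ≤ k := by exact_mod_cast (by omega : l ≤ k)
  exact lt_of_lt_of_le h2 (mul_le_mul_of_nonneg_right h5 hpi.le)

end StripTwist

/-- The vertical segment from a point up to a given height. -/
theorem isPreconnected_vertical (x : ℝ) (a b : ℝ) : IsPreconnected (pt x '' Icc a b) :=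
  isPreconnected_Icc.image _ (continuous_pt_right x).continuousOn

namespace Good

variable {K : Set StripA} (h : Good K)
include h

theorem image (f : StripTwist) : Good (f.F '' K) := h.map f.equi f.bot f.top

theorem image_symm (f : StripTwist) : Good (f.F.symm '' K) :=
  h.map f.equi.symm f.bot_symm f.top_symm

theorem angle_step (f : StripTwist) {z : StripA} {α α' : StripA → ℝ}
    (hα : IsAngle (Above K) z α) (hα' : IsAngle (Above (f.F '' K)) (f.F z) α') {k : ℤ}
    {w : StripA} (hw : w ∈ Above K) (hk : α w ≤ k * Real.pi) : α' (f.F w) < k * Real.pi :=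
  f.angle_step h.isOpen_above h.isPreconnected_above (fun _ => h.top_mem_above) hα
    (fun w hw => by rw [above_image f.top]; exact mem_image_of_mem _ hw) hα' hw hk

/-- If no point of `K` lies above `w` then `w` is in the region above `K`, with small angles. -/
theorem mem_above_of_lt {w : StripA} (hw : ∀ z ∈ K, ht z < ht w) : w ∈ Above K ∧
    ∀ z ∈ K, ∀ α, IsAngle (Above K) z α → |α w| < Real.pi / 2 := by
  have hC : IsPreconnected (pt w.1 '' Icc (ht w) 1) := isPreconnected_vertical _ _ _
  have hwC : w ∈ pt w.1 '' Icc (ht w) 1 := ⟨ht w, ⟨le_rfl, ht_le_one w⟩, pt_ht w⟩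
  have htC : pt w.1 1 ∈ pt w.1 '' Icc (ht w) 1 := ⟨1, ⟨ht_le_one w, le_rfl⟩, rfl⟩
  have ht1 : ht (pt w.1 1) = 1 := ht_pt zero_le_one le_rfl
  have hge : ∀ u ∈ pt w.1 '' Icc (ht w) 1, ht w ≤ ht u := by
    rintro _ ⟨y, hy, rfl⟩
    rw [ht_pt ((ht_nonneg w).trans hy.1) hy.2]
    exact hy.1
  have hCV := Reach.extend (U := Kᶜ) (h.top_mem_above ht1) htC
    (isCompact_Icc.image (continuous_pt_right _)) hC
    fun u hu hK => (hge u hu).not_gt (hw u hK)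
  exact ⟨hCV hwC, fun z hz α hα =>
    hα.abs_lt_of_above hC hCV htC ht1 (fun u hu => (hw z hz).trans_le (hge u hu)) hwC⟩

/-- If `|α w| < π` for all angles at points of `K`, the vertical segment from `w` to the top line
avoids `K`. -/
theorem vertical_subset_compl {w : StripA} (hw : w ∈ Above K)
    (hlt : ∀ z ∈ K, ∀ α, IsAngle (Above K) z α → |α w| < Real.pi) :
    pt w.1 '' Icc (ht w) 1 ⊆ Kᶜ := by
  rintro _ ⟨y, hy, rfl⟩ hK
  obtain ⟨α, hα⟩ := h.exists_angle hK
  have hle : ht w ≤ ht (pt w.1 y) := by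
    rw [ht_pt ((ht_nonneg w).trans hy.1) hy.2]
    exact hy.1
  have h1 := abs_lt.1 (hlt _ hK α hα)
  have h2 := (Real.sin_eq_zero_iff_of_lt_of_lt h1.1 h1.2).1 ((hα.sin_eq_zero_iff hw).2 rfl)
  obtain ⟨r, hr, h3, -⟩ := hα.polar w hw
  rw [h2, Real.cos_zero] at h3
  linarith

theorem vertical_subset_above {w : StripA} (hw : w ∈ Above K)
    (hlt : ∀ z ∈ K, ∀ α, IsAngle (Above K) z α → |α w| < Real.pi) :
    pt w.1 '' Icc (ht w) 1 ⊆ Above K :=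
  Reach.extend hw ⟨ht w, ⟨le_rfl, ht_le_one w⟩, pt_ht w⟩
    (isCompact_Icc.image (continuous_pt_right _)) (isPreconnected_vertical _ _ _)
    (h.vertical_subset_compl hw hlt)

end Good

/-- The points seen from some point of `K` with an angle greater than `π`. -/
def Wound (K : Set StripA) : Set StripA :=
  {w | w ∈ Above K ∧ ∃ z ∈ K, ∃ α, IsAngle (Above K) z α ∧ Real.pi < α w}

namespace Good

variable {K : Set StripA} (h : Good K)
include h

theorem isOpen_wound : IsOpen (Wound K) := by
  have : Wound K = ⋃ z ∈ K, ⋃ α, ⋃ _ : IsAngle (Above K) z α, Above K ∩ α ⁻¹' Ioi Real.pi := by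
    ext w
    simp only [Wound, mem_ofPred_eq, mem_iUnion, mem_inter_iff, mem_preimage, mem_Ioi]
    constructor
    · rintro ⟨h1, z, h2, α, h3, h4⟩
      exact ⟨z, h2, α, h3, h1, h4⟩
    · rintro ⟨z, h2, α, h3, h1, h4⟩
      exact ⟨h1, z, h2, α, h3, h4⟩
  rw [this]
  exact isOpen_biUnion fun z _ => isOpen_iUnion fun α => isOpen_iUnion fun hα =>
    hα.cont.isOpen_inter_preimage h.isOpen_above isOpen_Ioi

theorem pinv_wound : PInv (Wound K) := PInv.of_imp <| by
  rintro j w ⟨hw, z, hz, α, hα, hlt⟩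
  exact ⟨(h.pinv_above j w).2 hw, deckZ j z, (h.pinv j z).2 hz, _, hα.deck h.pinv_above j,
    by simpa using hlt⟩

/-- Points near the upper end of a vertical segment avoiding `K` are not wound if the lower end is
away from wound points. -/
theorem notMem_closure_wound {w v : StripA} (hwv : w.1 = v.1) (hle : ht w ≤ ht v)
    (hw : w ∉ closure (Wound K)) (hsub : pt w.1 '' Icc (ht w) 1 ⊆ Kᶜ) (hwV : w ∈ Above K) :
    v ∉ closure (Wound K) := by
  obtain ⟨δ, hδ, hth⟩ :=
    (isCompact_Icc.image (continuous_pt_right w.1)).exists_thickening_subset_open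
    h.closed.isOpen_compl hsub
  have hcont := (continuous_shift (ht w - ht v)).continuousAt (x := v)
  have e : pt v.1 (ht v + (ht w - ht v)) = w := by rw [add_sub_cancel, ← hwv, pt_ht]
  rw [ContinuousAt, e] at hcont
  have h1 : ∀ᶠ u in 𝓝 v, pt u.1 (ht u + (ht w - ht v)) ∈
      (closure (Wound K))ᶜ ∩ Above K ∩ Metric.ball w δ :=
    hcont.eventually_mem ((((isClosed_closure.isOpen_compl.inter h.isOpen_above).inter
      Metric.isOpen_ball).mem_nhds ⟨⟨hw, hwV⟩, Metric.mem_ball_self hδ⟩))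
  rw [mem_closure_iff_frequently, not_frequently]
  filter_upwards [h1, Metric.ball_mem_nhds v hδ] with u hu huv
  set u' := pt u.1 (ht u + (ht w - ht v))
  rintro ⟨huA, z, hz, α, hα, hlt⟩
  have hle' : ht u' ≤ ht u := ht_pt_le (ht_nonneg u) (by linarith)
  have hC : pt u.1 '' Icc (ht u') (ht u) ⊆ Above K := by
    refine Reach.extend (u := u') hu.1.2 ⟨ht u', ⟨le_rfl, hle'⟩, pt_ht u'⟩
      (isCompact_Icc.image (continuous_pt_right _)) (isPreconnected_vertical _ _ _) ?_
    rintro _ ⟨y, hy, rfl⟩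
    refine hth (Metric.mem_thickening_iff.2 ⟨pt w.1 (max y (ht w)),
      ⟨_, ⟨le_max_right _ _, max_le (hy.2.trans (ht_le_one u)) (ht_le_one w)⟩, rfl⟩, ?_⟩)
    have h2 := (fst_lipschitz u v).trans_lt huv
    have h3 := (ht_lipschitz u' w).trans_lt hu.2
    rw [← hwv] at h2
    refine strip_dist_lt h2 ?_
    rw [ht_pt ((ht_nonneg u').trans hy.1) (hy.2.trans (ht_le_one u)),
      ht_pt ((ht_nonneg w).trans (le_max_right _ _))
        (max_le (hy.2.trans (ht_le_one u)) (ht_le_one w))]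
    rw [abs_lt] at h3 ⊢
    rcases max_cases y (ht w) with ⟨e, h4⟩ | ⟨e, h4⟩ <;> rw [e]
    · constructor <;> linarith
    · constructor <;> linarith [hy.1]
  refine hu.1.1 (subset_closure ⟨hu.1.2, z, hz, α, hα, ?_⟩)
  have := hα.lt_of_vertical (isPreconnected_vertical u.1 (ht u') (ht u)) hC (x := u.1) (k := 1)
    (by rintro _ ⟨y, -, rfl⟩; rfl) (w := u) (w' := u') ⟨ht u, ⟨hle', le_rfl⟩, pt_ht u⟩
    ⟨ht u', ⟨le_rfl, hle'⟩, pt_ht u'⟩ (by simpa using hlt)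
  simpa using this

/-- An invariant good set reduces to the bottom line. -/
theorem ht_eq_zero_of_invariant (f : StripTwist) (hF : f.F '' K = K) : ∀ z ∈ K, ht z = 0 := by
  by_contra! hcon
  obtain ⟨z₀, hz₀, hz0⟩ := hcon
  have hKF : ∀ z, z ∈ K → f.F z ∈ K := fun z hz => hF ▸ mem_image_of_mem _ hz
  have hKF' : ∀ z, z ∈ K → f.F.symm z ∈ K := fun z hz => by
    rw [← hF] at hz
    obtain ⟨u, hu, rfl⟩ := hz
    rwa [Homeomorph.symm_apply_apply]
  have hVF : f.F '' Above K = Above K := by rw [← above_image f.top, hF]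
  have hVF' : ∀ w, f.F w ∈ Above K ↔ w ∈ Above K := fun w => by
    conv_lhs => rw [← hVF]
    exact f.F.injective.mem_set_image
  have step : ∀ {z α α'}, IsAngle (Above K) z α → IsAngle (Above K) (f.F z) α' →
      ∀ {k : ℤ} {w}, w ∈ Above K → α w ≤ k * Real.pi → α' (f.F w) < k * Real.pi := by
    intro z α α' hα hα' k w hw hk
    exact h.angle_step f hα (by rwa [hF]) hw hk
  have hWF : ∀ z ∈ Wound K, f.F.symm z ∈ Wound K := by
    rintro w ⟨hw, z, hz, α, hα, hlt⟩
    obtain ⟨β, hβ⟩ := h.exists_angle (hKF' z hz)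
    have hw' : f.F.symm w ∈ Above K := by rw [← hVF', Homeomorph.apply_symm_apply]; exact hw
    refine ⟨hw', _, hKF' z hz, β, hβ, ?_⟩
    by_contra hle
    have := step (α' := α) hβ (by rwa [Homeomorph.apply_symm_apply]) (k := 1) hw'
      (by simpa using hle)
    rw [Homeomorph.apply_symm_apply] at this
    simp only [Int.cast_one, one_mul] at this
    linarith
  have hcl := image_closure_eq f.equi.symm (f.recur.symm f.equi) h.isOpen_wound h.pinv_wound hWF
  have hWF' : ∀ w, f.F w ∈ closure (Wound K) ↔ w ∈ closure (Wound K) := fun w => by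
    conv_rhs => rw [← hcl]
    rw [← Homeomorph.symm_apply_apply f.F w, f.F.symm.injective.mem_set_image,
      Homeomorph.symm_apply_apply]
  have hltpi : ∀ w ∈ Above K, w ∉ closure (Wound K) → ∀ z ∈ K, ∀ α, IsAngle (Above K) z α →
      α w < Real.pi := by
    intro w hw hn z hz α hα
    obtain ⟨β, hβ⟩ := h.exists_angle (hKF' z hz)
    have hw' : f.F.symm w ∈ Above K := by rw [← hVF', Homeomorph.apply_symm_apply]; exact hw
    have hn' : f.F.symm w ∉ closure (Wound K) := by
      rw [← hWF', Homeomorph.apply_symm_apply]; exact hn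
    have hle : β (f.F.symm w) ≤ Real.pi := by
      by_contra hle
      exact hn' (subset_closure ⟨hw', _, hKF' z hz, β, hβ, not_le.1 hle⟩)
    have := step (α' := α) hβ (by rwa [Homeomorph.apply_symm_apply]) (k := 1) hw'
      (by simpa using hle)
    simpa using this
  set X : Set StripA := {w | w ∈ Above K ∧ w ∉ closure (Wound K) ∧
    ∀ z ∈ K, ∀ α, IsAngle (Above K) z α → -Real.pi < α w}
  obtain ⟨a, ha, hKa⟩ := h.exists_le
  have hbig : ∀ w, a < ht w → w ∈ X := by
    intro w hw
    have hw' : ∀ u, a < ht u → u ∉ Wound K := by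
      rintro u hu ⟨-, z, hz, α, hα, hlt⟩
      have := (h.mem_above_of_lt fun z hz => (hKa z hz).trans_lt hu).2 z hz α hα
      linarith [(abs_lt.1 this).2, Real.pi_pos]
    have hw2 := h.mem_above_of_lt fun z hz => (hKa z hz).trans_lt hw
    refine ⟨hw2.1, fun hc => ?_, fun z hz α hα => ?_⟩
    · obtain ⟨u, hu1, hu2⟩ := mem_closure_iff.1 hc _ (isOpen_lt continuous_const continuous_ht) hw
      exact hw' u hu1 hu2
    · linarith [(abs_lt.1 (hw2.2 z hz α hα)).1, Real.pi_pos]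
  have ha0 : 0 ≤ a := (ht_nonneg _).trans (hKa _ hz₀)
  have hmid : ht (pt 0 ((a + 1) / 2)) = (a + 1) / 2 := ht_pt (by linarith) (by linarith)
  refine f.no_invariant_upset (X := X) (w₀ := pt 0 ((a + 1) / 2)) ?_ ?_ ?_ ?_
    (hbig _ (by rw [hmid]; linarith)) (by rw [hmid]; linarith) (z₀ := z₀)
    (fun hX => notMem_above hz₀ hX.1) ((ht_nonneg _).lt_of_ne (Ne.symm hz0))
  · refine PInv.of_imp fun j w hw => ⟨(h.pinv_above j w).2 hw.1,
      fun hc => hw.2.1 ((h.pinv_wound.closure j w).1 hc), fun z hz α hα => ?_⟩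
    have := hw.2.2 _ ((h.pinv (-j) z).2 hz) _ (hα.deck h.pinv_above (-j))
    simpa using this
  · intro w v hwv hle hw
    have hlt : ∀ z ∈ K, ∀ α, IsAngle (Above K) z α → |α w| < Real.pi := fun z hz α hα =>
      abs_lt.2 ⟨hw.2.2 z hz α hα, hltpi w hw.1 hw.2.1 z hz α hα⟩
    have hCV := h.vertical_subset_above hw.1 hlt
    have hwC : w ∈ pt w.1 '' Icc (ht w) 1 := ⟨ht w, ⟨le_rfl, ht_le_one w⟩, pt_ht w⟩
    have hvC : v ∈ pt w.1 '' Icc (ht w) 1 := ⟨ht v, ⟨hle, ht_le_one v⟩, by rw [hwv, pt_ht]⟩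
    refine ⟨hCV hvC, h.notMem_closure_wound hwv hle hw.2.1 (h.vertical_subset_compl hw.1 hlt) hw.1,
      fun z hz α hα => ?_⟩
    have := hα.lt_of_vertical (isPreconnected_vertical w.1 (ht w) 1) hCV (x := w.1) (k := -1)
      (by rintro _ ⟨y, -, rfl⟩; rfl) hwC hvC (by simpa using hw.2.2 z hz α hα)
    simpa using this
  · intro z hz
    exact (ht_nonneg z).lt_of_ne fun e => notMem_above (h.bot z e.symm) hz.1
  · intro w hw
    have hwA := (hVF' w).1 hw.1
    refine ⟨hwA, fun hc => hw.2.1 ((hWF' w).2 hc), fun z hz α hα => ?_⟩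
    obtain ⟨β, hβ⟩ := h.exists_angle (hKF z hz)
    by_contra hle
    have h1 := step hα hβ (k := -1) hwA (by simpa using hle)
    have h2 := hw.2.2 _ (hKF z hz) β hβ
    simp only [Int.cast_neg, Int.cast_one, neg_mul, one_mul] at h1
    linarith

end Good

theorem reflTransGen_near_of_isPreconnected {C : Set StripA} (hC : IsPreconnected C) {ε : ℝ}
    (hε : 0 < ε) {p q : StripA} (hp : p ∈ C) (hq : q ∈ C) :
    Relation.ReflTransGen (Near C ε) p q := by
  refine hC.induction₂' (fun p q => Relation.ReflTransGen (Near C ε) p q) (fun x hx => ?_)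
    (fun x y z _ _ _ hxy hyz => hxy.trans hyz) hp hq
  filter_upwards [self_mem_nhdsWithin, mem_nhdsWithin_of_mem_nhds (Metric.ball_mem_nhds x hε)]
    with y hy hd
  exact ⟨.single ⟨hx, hy, by rw [dist_comm]; exact hd⟩, .single ⟨hy, hx, hd⟩⟩

theorem Reach.closure_inter_subset {A U : Set StripA} (hU : IsOpen U) :
    closure (Reach A U) ∩ U ⊆ Reach A U := by
  rintro w ⟨hw, hwU⟩
  obtain ⟨ε, hε, h⟩ := Metric.isOpen_iff.1 hU w hwU
  obtain ⟨u, hu, hd⟩ := Metric.mem_closure_iff.1 hw ε hε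
  exact extend hu (right_mem_seg w u) (isCompact_seg w u) (isPreconnected_seg w u)
    (fun v hv => h ((dist_le_of_mem_seg hv).trans_lt hd)) (left_mem_seg w u)

theorem Reach.chained_closure {A U : Set StripA} : Chained A (closure (Reach A U)) := by
  intro ε hε z hz
  obtain ⟨u, hu, hd⟩ := Metric.mem_closure_iff.1 hz ε hε
  obtain ⟨C, -, hC, hCR, huC, p, hpC, hpA⟩ := exists_continuum hu
  have hmono : Near C ε ≤ Near (closure (Reach A U)) ε := fun a b hab =>
    ⟨subset_closure (hCR hab.1), subset_closure (hCR hab.2.1), hab.2.2⟩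
  exact ⟨p, hpA, .tail (Relation.ReflTransGen.mono hmono _ _
    (reflTransGen_near_of_isPreconnected hC hε hpC huC))
    ⟨subset_closure hu, hz, by rw [dist_comm]; exact hd⟩⟩

theorem isClosed_far (K : Set StripA) (δ : ℝ) : IsClosed (Far K δ) := by
  have : Far K δ = ⋂ z ∈ K, {w | δ ≤ dist w z} := by
    ext w
    simp [Far]
  rw [this]
  exact isClosed_biInter fun z _ =>
    isClosed_le continuous_const (continuous_id.dist continuous_const)

theorem PInv.far {K : Set StripA} (h : PInv K) (δ : ℝ) : PInv (Far K δ) := PInv.of_imp <| by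
  intro j w hw z hz
  have := hw _ ((h (-j) z).2 hz)
  rwa [← dist_deckZ j, deckZ_deckZ_neg] at this

/-- A decreasing intersection of chained closed sets is chained. -/
theorem Chained.iInter {A : Set StripA} {Q : ℕ → Set StripA} (hp : ∀ n, PInv (Q n))
    (hc : ∀ n, IsClosed (Q n)) (ha : ∀ n, Q (n + 1) ⊆ Q n) (hA : ∀ n, A ⊆ Q n)
    (hch : ∀ n, Chained A (Q n)) : Chained A (⋂ n, Q n) := by
  intro ε hε z hz
  obtain ⟨n, hn⟩ : ∃ n, ¬ (Q n ∩ Far (⋂ n, Q n) (ε / 3)).Nonempty := by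
    by_contra! hcon
    obtain ⟨w, hw⟩ := PInv.nonempty_iInter
      (fun n => (hp n).inter ((PInv.iInter hp).far (ε / 3)))
      (fun n => (hc n).inter (isClosed_far _ _)) (fun n => inter_subset_inter_left _ (ha n)) hcon
    rw [mem_iInter] at hw
    have := (hw 0).2 w (mem_iInter.2 fun n => (hw n).1)
    rw [dist_self] at this
    linarith
  have hnear : ∀ w ∈ Q n, ∃ v ∈ ⋂ n, Q n, dist w v < ε / 3 := by
    intro w hw
    by_contra! hcon
    exact hn ⟨w, hw, fun v hv => hcon v hv⟩
  have hg : ∀ w, ∃ v, (w ∈ ⋂ n, Q n → v = w) ∧ (w ∈ Q n → v ∈ ⋂ n, Q n ∧ dist w v < ε / 3) := by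
    intro w
    by_cases h1 : w ∈ ⋂ n, Q n
    · exact ⟨w, fun _ => rfl, fun _ => ⟨h1, by rw [dist_self]; positivity⟩⟩
    · by_cases h2 : w ∈ Q n
      · obtain ⟨v, hv⟩ := hnear w h2
        exact ⟨v, fun h => absurd h h1, fun _ => hv⟩
      · exact ⟨w, fun _ => rfl, fun h => absurd h h2⟩
  choose g hg1 hg2 using hg
  obtain ⟨p, hpA, hpz⟩ := hch n (ε / 3) (by positivity) z (mem_iInter.1 hz n)
  refine ⟨p, hpA, ?_⟩
  have : Relation.ReflTransGen (Near (⋂ n, Q n) ε) (g p) (g z) := hpz.lift g fun a b hab => by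
    obtain ⟨h1, h2⟩ := hg2 a hab.1
    obtain ⟨h3, h4⟩ := hg2 b hab.2.1
    refine ⟨h1, h3, ?_⟩
    have := dist_triangle4 (g a) a b (g b)
    rw [dist_comm (g a) a] at this
    linarith [hab.2.2]
  rwa [hg1 p (mem_iInter.2 fun n => hA n hpA), hg1 z hz] at this

theorem Good.iInter {Q : ℕ → Set StripA} (h : ∀ n, Good (Q n)) (ha : ∀ n, Q (n + 1) ⊆ Q n) :
    Good (⋂ n, Q n) where
  closed := isClosed_iInter fun n => (h n).closed
  pinv := PInv.iInter fun n => (h n).pinv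
  bot z hz := mem_iInter.2 fun n => (h n).bot z hz
  lt_one z hz := (h 0).lt_one z (mem_iInter.1 hz 0)
  chain := Chained.iInter (fun n => (h n).pinv) (fun n => (h n).closed) ha (fun n => (h n).bot)
    fun n => (h n).chain

namespace StripTwist

variable (f : StripTwist)

/-- The points whose first `n` backward iterates stay in the lower half of the strip. -/
def Low (n : ℕ) : Set StripA := {z | ∀ k ≤ n, ht (f.F.symm^[k] z) < 1 / 2}

/-- The closure of the part of `Low n` attached to the bottom line. -/
def LowCl (n : ℕ) : Set StripA := closure (Reach {z | ht z = 0} (f.Low n))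

theorem isOpen_low (n : ℕ) : IsOpen (f.Low n) := by
  have : f.Low n = ⋂ k ∈ Iic n, {z | ht (f.F.symm^[k] z) < 1 / 2} := by
    ext z
    simp [Low]
  rw [this]
  exact (finite_Iic n).isOpen_biInter fun k _ =>
    isOpen_lt (continuous_ht.comp (f.F.symm.continuous.iterate k)) continuous_const

theorem pinv_low (n : ℕ) : PInv (f.Low n) := fun j z => by
  simp [Low, f.equi.symm.iterate]

theorem symm_iterate_bot (n : ℕ) {z : StripA} (hz : ht z = 0) : ht (f.F.symm^[n] z) = 0 := by
  induction n with
  | zero => exact hz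
  | succ n ih => rw [Function.iterate_succ_apply', f.bot_symm, ih]

theorem low_of_bot (n : ℕ) {z : StripA} (hz : ht z = 0) : z ∈ f.Low n := fun k _ => by
  rw [f.symm_iterate_bot k hz]; norm_num

theorem good_lowCl (n : ℕ) : Good (f.LowCl n) where
  closed := isClosed_closure
  pinv := (Reach.pinv (PInv.ht_pred (· = 0)) (f.pinv_low n)).closure
  bot z hz := subset_closure (Reach.of_mem hz (f.low_of_bot n hz))
  lt_one z hz := by
    have : f.LowCl n ⊆ {z | ht z ≤ 1 / 2} :=
      closure_minimal (fun z hz => (Reach.subset hz 0 (Nat.zero_le n)).le)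
        (isClosed_le continuous_ht continuous_const)
    exact (this hz).trans_lt (by norm_num)
  chain := Reach.chained_closure

theorem lowCl_succ_subset (n : ℕ) : f.LowCl (n + 1) ⊆ f.LowCl n :=
  closure_mono (Reach.mono fun _ hz k hk => hz k (by omega))

theorem symm_mem_lowCl {n : ℕ} {z : StripA} (hz : z ∈ f.LowCl (n + 1)) :
    f.F.symm z ∈ f.LowCl n :=
  map_mem_closure f.F.symm.continuous hz fun _ hu =>
    Reach.map (U := f.Low (n + 1)) (U' := f.Low n) f.F.symm (fun v hv => (f.bot_symm v).2 hv)
      (fun v hv k hk => hv (k + 1) (by omega)) hu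

theorem exists_mem_lowCl (n : ℕ) : ∃ z ∈ f.LowCl n, ht z = 1 / 2 := by
  by_contra! hcon
  set R := Reach {z | ht z = 0} (f.Low n)
  have hlt : ∀ z ∈ f.LowCl n, ht z < 1 / 2 := fun z hz => by
    have : f.LowCl n ⊆ {z | ht z ≤ 1 / 2} :=
      closure_minimal (fun z hz => (Reach.subset hz 0 (Nat.zero_le n)).le)
        (isClosed_le continuous_ht continuous_const)
    exact (this hz).lt_of_ne (hcon z hz)
  have hRo : IsOpen R := Reach.isOpen (f.isOpen_low n)
  have hbot : ∀ z, ht z = 0 → z ∈ R := fun z hz => Reach.of_mem hz (f.low_of_bot n hz)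
  have hF : ∀ z ∈ R, f.F z ∈ R := by
    intro z hz
    obtain ⟨C, -, hC, hCR, hzC, p, hpC, hp⟩ := Reach.exists_continuum hz
    refine (hC.image f.F f.F.continuous.continuousOn).subset_of_closure_inter_subset hRo
      ⟨f.F p, mem_image_of_mem _ hpC, hbot _ ((f.bot p).2 hp)⟩ ?_ (mem_image_of_mem _ hzC)
    rintro _ ⟨hv, c, hc, rfl⟩
    refine Reach.closure_inter_subset (f.isOpen_low n) ⟨hv, fun k hk => ?_⟩
    rcases k with _ | k
    · exact hlt _ hv
    · rw [Function.iterate_succ_apply, Homeomorph.symm_apply_apply]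
      exact Reach.subset (hCR hc) k (by omega)
  have hcl : f.F '' f.LowCl n = f.LowCl n := image_closure_eq f.equi f.recur hRo
    (Reach.pinv (PInv.ht_pred (· = 0)) (f.pinv_low n)) hF
  have hback : ∀ z ∈ f.LowCl n, ∀ k, f.F.symm^[k] z ∈ f.LowCl n := by
    intro z hz k
    induction k with
    | zero => exact hz
    | succ k ih =>
      rw [Function.iterate_succ_apply']
      rw [← hcl] at ih
      obtain ⟨u, hu, e⟩ := ih
      rwa [← e, Homeomorph.symm_apply_apply]
  have hsub : f.LowCl n ⊆ R := fun z hz =>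
    Reach.closure_inter_subset (f.isOpen_low n) ⟨hz, fun k _ => hlt _ (hback z hz k)⟩
  have := (isPreconnected_vertical 0 0 1).subset_of_closure_inter_subset hRo
    ⟨pt 0 0, ⟨0, ⟨le_rfl, zero_le_one⟩, rfl⟩, hbot _ (ht_pt le_rfl zero_le_one)⟩
    (fun z hz => hsub hz.1) ⟨1, ⟨zero_le_one, le_rfl⟩, rfl⟩
  have := Reach.subset this 0 (Nat.zero_le n)
  rw [Function.iterate_zero_apply, ht_pt zero_le_one le_rfl] at this
  norm_num at this

/-- A nontrivial orbit of good sets emanating from the bottom line. -/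
structure Family (K : ℤ → Set StripA) : Prop where
  good : ∀ m, Good (K m)
  step : ∀ m z, f.F z ∈ K (m + 1) ↔ z ∈ K m
  lim : ∀ ε > 0, ∃ N, ∀ m ≤ N, ∀ z ∈ K m, ht z < ε
  exists_pos : ∃ z ∈ K 0, 0 < ht z

theorem exists_family : ∃ K, f.Family K := by
  set Q := ⋂ n, f.LowCl n
  have hQ : Good Q := Good.iInter f.good_lowCl f.lowCl_succ_subset
  have hQF : ∀ z ∈ Q, f.F.symm z ∈ Q := fun z hz =>
    mem_iInter.2 fun n => f.symm_mem_lowCl (mem_iInter.1 hz (n + 1))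
  obtain ⟨z₀, hz₀⟩ := PInv.nonempty_iInter (Q := fun n => f.LowCl n ∩ {z | ht z = 1 / 2})
    (fun n => (f.good_lowCl n).pinv.inter (PInv.ht_pred (· = 1 / 2)))
    (fun n => (f.good_lowCl n).closed.inter (isClosed_eq continuous_ht continuous_const))
    (fun n => inter_subset_inter_left _ (f.lowCl_succ_subset n)) f.exists_mem_lowCl
  rw [mem_iInter] at hz₀
  let K : ℤ → Set StripA := fun m => (f.F ^ (-m) : StripA ≃ₜ StripA) ⁻¹' Q
  have hstep : ∀ m z, f.F z ∈ K (m + 1) ↔ z ∈ K m := fun m z => by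
    have : (f.F ^ (-(m + 1)) : StripA ≃ₜ StripA) (f.F z) = (f.F ^ (-m) : StripA ≃ₜ StripA) z := by
      have e : f.F ^ (-(m + 1)) * f.F = f.F ^ (-m) := by
        rw [← zpow_add_one]; congr 1; ring
      rw [← e]; rfl
    simp only [K, mem_preimage, this]
  have himage : ∀ m, f.F '' K m = K (m + 1) := fun m => by
    ext w
    constructor
    · rintro ⟨z, hz, rfl⟩
      exact (hstep m z).2 hz
    · intro hw
      exact ⟨f.F.symm w, (hstep m _).1 (by rwa [Homeomorph.apply_symm_apply]),
        Homeomorph.apply_symm_apply _ _⟩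
  have himage' : ∀ m, f.F.symm '' K (m + 1) = K m := fun m => by
    rw [← himage, ← image_comp]
    simp
  have hK0 : K 0 = Q := by simp [K]; rfl
  have hgood : ∀ m, Good (K m) := fun m => by
    induction m with
    | zero => rwa [hK0]
    | succ m ih => rw [← himage]; exact ih.image f
    | pred m ih =>
      rw [← himage', sub_add_cancel]
      exact ih.image_symm f
  have hmono : Monotone K := monotone_int_of_le_succ fun m z hz => by
    have e : (f.F ^ (-(m + 1)) : StripA ≃ₜ StripA) z =
        f.F.symm ((f.F ^ (-m) : StripA ≃ₜ StripA) z) := by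
      have e : f.F ^ (-(m + 1)) = f.F⁻¹ * f.F ^ (-m) := by
        rw [← zpow_neg_one, ← zpow_add]; congr 1; ring
      rw [e]; rfl
    simp only [K, mem_preimage, e]
    exact hQF _ hz
  have hinf : f.F '' (⋂ n : ℕ, K (-n)) = ⋂ n : ℕ, K (-n) := by
    apply Subset.antisymm
    · rintro _ ⟨z, hz, rfl⟩
      rw [mem_iInter] at hz ⊢
      intro n
      have := (hstep _ _).2 (hz (n + 1))
      rwa [show -((n + 1 : ℕ) : ℤ) + 1 = -n by push_cast; ring] at this
    · intro w hw
      refine ⟨f.F.symm w, mem_iInter.2 fun n => (hstep _ _).1 ?_, Homeomorph.apply_symm_apply _ _⟩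
      rw [Homeomorph.apply_symm_apply]
      exact hmono (by omega) (mem_iInter.1 hw n)
  have hanti : ∀ n : ℕ, K (-(n + 1 : ℕ)) ⊆ K (-n) := fun n => hmono (by omega)
  have hzero := (Good.iInter (fun n => hgood (-n)) hanti).ht_eq_zero_of_invariant f hinf
  refine ⟨K, hgood, hstep, fun ε hε => ?_, z₀, ?_, ?_⟩
  · by_contra! hcon
    obtain ⟨w, hw⟩ := PInv.nonempty_iInter (Q := fun n : ℕ => K (-n) ∩ {z | ε ≤ ht z})
      (fun n => (hgood _).pinv.inter (PInv.ht_pred (ε ≤ ·)))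
      (fun n => (hgood _).closed.inter (isClosed_le continuous_const continuous_ht))
      (fun n => inter_subset_inter_left _ (hanti n)) fun n => by
        obtain ⟨m, hm, z, hz, hε⟩ := hcon (-n)
        exact ⟨z, hmono hm hz, hε⟩
    rw [mem_iInter] at hw
    have := hzero w (mem_iInter.2 fun n => (hw n).1)
    linarith [show ε ≤ ht w from (hw 0).2]
  · rw [hK0]
    exact mem_iInter.2 fun n => (hz₀ n).1
  · rw [show ht z₀ = 1 / 2 from (hz₀ 0).2]; norm_num

end StripTwist

theorem PInv.exists_pos_le_dist {K L : Set StripA} (hK : IsClosed K) (hKp : PInv K)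
    (hKne : K.Nonempty) (hL : IsClosed L) (hLp : PInv L) (hd : ∀ z ∈ K, z ∉ L) :
    ∃ b > 0, ∀ z ∈ K, ∀ w ∈ L, b ≤ dist w z := by
  obtain ⟨b, hb, H⟩ := hLp.exists_pos_le hL (g := fun w => Metric.infDist w K)
    (Metric.continuous_infDist_pt K) (fun j z => by
      have hj : deckZ j '' K = K := by
        ext w
        constructor
        · rintro ⟨u, hu, rfl⟩
          exact (hKp j u).2 hu
        · exact fun hw => ⟨deckZ (-j) w, (hKp _ w).2 hw, deckZ_deckZ_neg j w⟩
      conv_lhs => rw [← hj]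
      exact Metric.infDist_image (Isometry.of_dist_eq (dist_deckZ j)))
    fun w hw => (hK.notMem_iff_infDist_pos hKne).1 fun hwK => hd w hwK hw
  exact ⟨b, hb, fun z hz w hw => (H w hw).trans (Metric.infDist_le_dist_of_mem hz)⟩

theorem Chained.subset_reach {A L U : Set StripA} (h : Chained A L) (hA : A ⊆ U) {b : ℝ}
    (hb : 0 < b) (hU : ∀ p ∈ L, ∀ q ∈ L, dist p q < b → seg p q ⊆ U) : L ⊆ Reach A U := by
  intro z hz
  obtain ⟨p, hp, hpz⟩ := h b hb z hz
  induction hpz with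
  | refl => exact Reach.of_mem hp (hA hp)
  | tail _ hq ih =>
    exact Reach.extend (ih hq.1) (left_mem_seg _ _) (isCompact_seg _ _) (isPreconnected_seg _ _)
      (hU _ hq.1 _ hq.2.1 hq.2.2) (right_mem_seg _ _)

theorem Good.angle_unique {K : Set StripA} (h : Good K) {z : StripA} {α β : StripA → ℝ}
    (hα : IsAngle (Above K) z α) (hβ : IsAngle (Above K) z β) {w : StripA} (hw : w ∈ Above K) :
    α w = β w :=
  have ht1 : ht (pt 0 1) = 1 := ht_pt zero_le_one le_rfl
  hα.eqOn hβ h.isPreconnected_above subset_rfl subset_rfl (h.top_mem_above ht1) ht1 hw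

namespace StripTwist

variable {f : StripTwist}

theorem iterate_mem {S : ℤ → Set StripA} (h : ∀ m z, f.F z ∈ S (m + 1) ↔ z ∈ S m) (n : ℕ) (m : ℤ)
    (z : StripA) : f.F^[n] z ∈ S (m + n) ↔ z ∈ S m := by
  induction n generalizing m z with
  | zero => simp
  | succ n ih =>
    rw [Function.iterate_succ_apply, ← h m z, ← ih (m + 1),
      show m + 1 + (n : ℤ) = m + (n + 1 : ℕ) by push_cast; ring]

theorem symm_iterate_mem {S : ℤ → Set StripA} (h : ∀ m z, f.F z ∈ S (m + 1) ↔ z ∈ S m) (n : ℕ)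
    (m : ℤ) (z : StripA) : f.F.symm^[n] z ∈ S (m - n) ↔ z ∈ S m := by
  rw [← iterate_mem h n, iterate_iterate_symm, sub_add_cancel]

/-- The orbit of `z` goes from the bottom line to the top line. -/
def Connects (f : StripTwist) (z : StripA) : Prop :=
  0 < ht z ∧ ht z < 1 ∧ Tendsto (fun n => ht (f.F.symm^[n] z)) atTop (𝓝 0) ∧
    Tendsto (fun n => ht (f.F^[n] z)) atTop (𝓝 1)

/-- A nontrivial orbit of closed sets attached to the top line and converging to it. -/
structure CoFamily (f : StripTwist) (L : ℤ → Set StripA) : Prop where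
  closed : ∀ m, IsClosed (L m)
  pinv : ∀ m, PInv (L m)
  pos : ∀ m, ∀ z ∈ L m, 0 < ht z
  chain : ∀ m, Chained {z | ht z = 1} (L m)
  step : ∀ m z, f.F z ∈ L (m + 1) ↔ z ∈ L m
  lim : ∀ ε > 0, ∃ N, ∀ m ≥ N, ∀ z ∈ L m, 1 - ε < ht z
  exists_lt_one : ∃ z ∈ L 0, ht z < 1

theorem dist_refl (z w : StripA) : dist (refl z) (refl w) = dist z w := by
  simp only [Prod.dist_eq, refl_fst]
  congr 1
  have hz : ((refl z).2 : ℝ) = 1 - z.2 := ht_refl z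
  have hw : ((refl w).2 : ℝ) = 1 - w.2 := ht_refl w
  rw [Subtype.dist_eq, Subtype.dist_eq, hz, hw, Real.dist_eq, Real.dist_eq, abs_sub_comm]
  congr 1; ring

theorem exists_coFamily (f : StripTwist) : ∃ L, f.CoFamily L := by
  obtain ⟨K, hK⟩ := f.flip.exists_family
  refine ⟨fun m => refl ⁻¹' K (-m), fun m => (hK.good _).closed.preimage refl.continuous,
    fun m j z => (hK.good _).pinv j (refl z), fun m z hz => ?_, fun m ε hε z hz => ?_,
    fun m z => ?_, fun ε hε => ?_, ?_⟩
  · have := (hK.good _).lt_one _ hz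
    rw [ht_refl] at this
    linarith
  · obtain ⟨p, hp, hpz⟩ := (hK.good _).chain ε hε (refl z) hz
    refine ⟨refl p, ?_, ?_⟩
    · rw [mem_ofPred_eq] at hp ⊢
      rw [ht_refl, hp, sub_zero]
    have : Relation.ReflTransGen (Near (refl ⁻¹' K (-m)) ε) (refl p) (refl (refl z)) :=
      hpz.lift refl fun a b hab => ⟨by simpa using hab.1, by simpa using hab.2.1,
        by rw [dist_refl]; exact hab.2.2⟩
    rwa [refl_refl] at this
  · have := hK.step (-(m + 1)) (refl (f.F z))
    rw [show f.flip.F (refl (f.F z)) = refl z by simp [flip],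
      show -(m + 1) + 1 = -m by ring] at this
    exact this.symm
  · obtain ⟨N, hN⟩ := hK.lim ε hε
    refine ⟨-N, fun m hm z hz => ?_⟩
    have := hN (-m) (by linarith) _ hz
    rw [ht_refl] at this
    linarith
  · obtain ⟨z, hz, hz0⟩ := hK.exists_pos
    exact ⟨refl z, by simpa using hz, by rw [ht_refl]; linarith⟩

theorem CoFamily.tendsto {L : ℤ → Set StripA} (hL : f.CoFamily L) {n : ℤ} {z : StripA}
    (hz : z ∈ L n) : Tendsto (fun k => ht (f.F^[k] z)) atTop (𝓝 1) := by
  refine tendsto_order.2 ⟨fun a ha => ?_, fun a ha => ?_⟩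
  · obtain ⟨N, hN⟩ := hL.lim (1 - a) (by linarith)
    filter_upwards [eventually_ge_atTop (N - n).toNat] with k hk
    have := hN (n + k) (by omega) _ ((iterate_mem hL.step k n z).2 hz)
    linarith
  · exact Eventually.of_forall fun k => (ht_le_one _).trans_lt ha

namespace Family

variable {K L : ℤ → Set StripA} (hK : f.Family K)
include hK

theorem tendsto {m : ℤ} {z : StripA} (hz : z ∈ K m) :
    Tendsto (fun k => ht (f.F.symm^[k] z)) atTop (𝓝 0) := by
  refine tendsto_order.2 ⟨fun a ha => ?_, fun a ha => ?_⟩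
  · exact Eventually.of_forall fun k => ha.trans_le (ht_nonneg _)
  · obtain ⟨N, hN⟩ := hK.lim a ha
    filter_upwards [eventually_ge_atTop (m - N).toNat] with k hk
    exact hN (m - k) (by omega) _ ((symm_iterate_mem hK.step k m z).2 hz)

theorem image (m : ℤ) : f.F '' K m = K (m + 1) := by
  ext w
  constructor
  · rintro ⟨z, hz, rfl⟩
    exact (hK.step m z).2 hz
  · intro hw
    exact ⟨f.F.symm w, (hK.step m _).1 (by rwa [Homeomorph.apply_symm_apply]),
      Homeomorph.apply_symm_apply _ _⟩

theorem above_step (m : ℤ) (z : StripA) : f.F z ∈ Above (K (m + 1)) ↔ z ∈ Above (K m) := by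
  rw [← hK.image, above_image f.top, f.F.injective.mem_set_image]

theorem angle_step {m : ℤ} {z : StripA} {α α' : StripA → ℝ} (hα : IsAngle (Above (K m)) z α)
    (hα' : IsAngle (Above (K (m + 1))) (f.F z) α') {k : ℤ} {w : StripA} (hw : w ∈ Above (K m))
    (hk : α w ≤ k * Real.pi) : α' (f.F w) < k * Real.pi :=
  (hK.good m).angle_step f hα (by rwa [hK.image]) hw hk

theorem angle_iterate {m : ℤ} {z : StripA} {α : StripA → ℝ} (hz : z ∈ K m)
    (hα : IsAngle (Above (K m)) z α) {k : ℤ} {w : StripA} (hw : w ∈ Above (K m))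
    (hk : α w ≤ k * Real.pi) (n : ℕ) :
    ∃ β, IsAngle (Above (K (m + n))) (f.F^[n] z) β ∧ β (f.F^[n] w) ≤ k * Real.pi := by
  induction n with
  | zero => exact ⟨α, by simpa using hα, hk⟩
  | succ n ih =>
    obtain ⟨β, hβ, hle⟩ := ih
    obtain ⟨γ, hγ⟩ := (hK.good (m + n + 1)).exists_angle
      ((hK.step _ _).2 ((iterate_mem hK.step n m z).2 hz))
    refine ⟨γ, ?_, ?_⟩
    · rw [Function.iterate_succ_apply']
      convert hγ using 3
      push_cast; ring
    · rw [Function.iterate_succ_apply']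
      exact (hK.angle_step hβ hγ 
        ((iterate_mem (S := fun m => Above (K m)) hK.above_step n m w).2 hw) hle).le

theorem ht_pos_of_mem_above {m : ℤ} {w : StripA} (hw : w ∈ Above (K m)) : 0 < ht w :=
  (ht_nonneg w).lt_of_ne fun h => notMem_above ((hK.good m).bot w h.symm) hw

theorem angle_le_pi {m : ℤ} {z : StripA} {α : StripA → ℝ} (hz : z ∈ K m)
    (hα : IsAngle (Above (K m)) z α) {w : StripA} (hw : w ∈ Above (K m)) : α w ≤ Real.pi := by
  by_contra! hlt
  have hw0 := hK.ht_pos_of_mem_above hw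
  obtain ⟨N, hN⟩ := hK.lim (ht w / 2) (by linarith)
  obtain ⟨k, hk, u, ⟨⟨hu, huα⟩, -⟩, j, -, hj⟩ := f.recur.symm f.equi
    ((Above (K m) ∩ α ⁻¹' Ioi Real.pi) ∩ {u | ht w / 2 < ht u})
    ((hα.cont.isOpen_inter_preimage (hK.good m).isOpen_above isOpen_Ioi).inter
      (isOpen_lt continuous_const continuous_ht)) ⟨w, ⟨hw, hlt⟩, by
        rw [mem_ofPred_eq]; linarith⟩ (m - N).toNat
  rw [mem_ofPred_eq, ht_deckZ] at hj
  have hz' := (symm_iterate_mem hK.step k m z).2 hz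
  have hu' := (hK.good (m - k)).mem_above_of_lt (w := f.F.symm^[k] u) fun v hv =>
    (hN (m - k) (by omega) v hv).trans hj
  obtain ⟨β, hβ⟩ := (hK.good (m - k)).exists_angle hz'
  have hle : β (f.F.symm^[k] u) ≤ (1 : ℤ) * Real.pi := by
    have := (abs_lt.1 (hu'.2 _ hz' β hβ)).2
    push_cast
    linarith [Real.pi_pos]
  obtain ⟨γ, hγ, hγ'⟩ := hK.angle_iterate hz' hβ hu'.1 hle k
  rw [iterate_iterate_symm, sub_add_cancel] at hγ
  rw [iterate_iterate_symm, ← (hK.good m).angle_unique hα hγ hu] at hγ'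
  push_cast at hγ'
  linarith [show Real.pi < α u from huα]

theorem angle_lt_pi {m : ℤ} {z : StripA} {α : StripA → ℝ} (hz : z ∈ K m)
    (hα : IsAngle (Above (K m)) z α) {w : StripA} (hw : w ∈ Above (K m)) : α w < Real.pi := by
  obtain ⟨m, rfl⟩ : ∃ n, m = n + 1 := ⟨m - 1, by ring⟩
  have hz' : f.F.symm z ∈ K m := (hK.step m _).1 (by rwa [Homeomorph.apply_symm_apply])
  have hw' : f.F.symm w ∈ Above (K m) :=
    (hK.above_step m _).1 (by rwa [Homeomorph.apply_symm_apply])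
  obtain ⟨β, hβ⟩ := (hK.good m).exists_angle hz'
  have := hK.angle_step (α' := α) hβ (by rwa [Homeomorph.apply_symm_apply]) (k := 1) hw'
    (by simpa using hK.angle_le_pi hz' hβ hw')
  simpa using this

variable (hL : f.CoFamily L) (hno : ∀ z, ¬ f.Connects z)
include hL hno

theorem notMem_coFamily {m n : ℤ} {z : StripA} (hz : z ∈ K m) : z ∉ L n := fun hzL =>
  hno z ⟨hL.pos n z hzL, (hK.good m).lt_one z hz, hK.tendsto hz, hL.tendsto hzL⟩

theorem coFamily_subset_reach {m n : ℤ} {c : ℝ} (hc : c < 1) (hcL : ∀ z ∈ L n, c < ht z) :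
    L n ⊆ Reach {z | ht z = 1} ((K m)ᶜ ∩ {z | c < ht z}) := by
  have hG := hK.good m
  obtain ⟨b, hb, H⟩ := PInv.exists_pos_le_dist hG.closed hG.pinv
    ⟨pt 0 0, hG.bot _ (ht_pt le_rfl zero_le_one)⟩ (hL.closed n) (hL.pinv n)
    fun z hz => hK.notMem_coFamily hL hno hz
  refine (hL.chain n).subset_reach (fun z hz => ⟨fun hzK => (hG.lt_one z hzK).ne hz, ?_⟩) hb
    fun p hp q hq hpq u hu => ⟨fun huK => ?_, lt_ht_of_mem_seg hu (hcL p hp) (hcL q hq)⟩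
  · rw [mem_ofPred_eq] at hz ⊢
    rwa [hz]
  · have := H u huK p hp
    rw [dist_comm] at this
    linarith [dist_le_of_mem_seg hu]

theorem coFamily_subset_above {m n : ℤ} : L n ⊆ Above (K m) :=
  (hK.coFamily_subset_reach hL hno (c := 0) zero_lt_one (hL.pos n)).trans
    (Reach.mono inter_subset_left)

theorem neg_pi_lt_angle {m n : ℤ} {z : StripA} {α : StripA → ℝ} (hz : z ∈ K m)
    (hα : IsAngle (Above (K m)) z α) {w : StripA} (hw : w ∈ L n) : -Real.pi < α w := by
  by_contra! hle
  have hlim : Tendsto (fun k => ht (f.F^[k] z)) atTop (𝓝 1) := by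
    refine tendsto_order.2 ⟨fun a ha => ?_, fun a ha => ?_⟩
    · obtain ⟨N, hN⟩ := hL.lim (1 - a) (by linarith)
      filter_upwards [eventually_ge_atTop (N - n).toNat] with k hk
      by_contra! hza
      obtain ⟨β, hβ, hβ'⟩ := hK.angle_iterate (k := -1) hz hα
        (hK.coFamily_subset_above hL hno hw) (by push_cast; linarith) k
      obtain ⟨C, -, hC, hCR, hwC, t, htC, ht1⟩ := Reach.exists_continuum
        (hK.coFamily_subset_reach hL hno (m := m + k) (n := n + k) ha
          (fun v hv => by linarith [hN (n + k) (by omega) v hv])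
          ((iterate_mem hL.step k n w).2 hw))
      have := hβ.abs_lt_of_above hC (hCR.trans (Reach.mono inter_subset_left)) htC ht1
        (fun u hu => hza.trans_lt (Reach.subset (hCR hu)).2) hwC
      push_cast at hβ'
      linarith [(abs_lt.1 this).1, Real.pi_pos]
    · exact Eventually.of_forall fun k => (ht_le_one _).trans_lt ha
  refine hno z ⟨(ht_nonneg z).lt_of_ne fun h => ?_, (hK.good m).lt_one z hz, hK.tendsto hz, hlim⟩
  have h0 : ∀ k, ht (f.F^[k] z) = 0 := fun k => by
    induction k with
    | zero => exact h.symm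
    | succ k ih => rwa [Function.iterate_succ_apply', f.bot]
  simp only [h0] at hlim
  exact zero_ne_one (tendsto_nhds_unique tendsto_const_nhds hlim)

end Family

theorem exists_connects (f : StripTwist) : ∃ z, f.Connects z := by
  by_contra! hno
  obtain ⟨K, hK⟩ := f.exists_family
  obtain ⟨L, hL⟩ := f.exists_coFamily
  obtain ⟨w₀, hw₀, hw1⟩ := hL.exists_lt_one
  obtain ⟨z₀, hz₀, hz0⟩ := hK.exists_pos
  refine f.no_invariant_upset (X := {w | ∀ m, w ∈ Above (K m) ∧
    ∀ z ∈ K m, ∀ α, IsAngle (Above (K m)) z α → -Real.pi < α w}) ?_ ?_ ?_ ?_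
    (w₀ := w₀) (fun m => ⟨hK.coFamily_subset_above hL hno hw₀,
      fun z hz α hα => hK.neg_pi_lt_angle hL hno hz hα hw₀⟩) hw1
    (z₀ := z₀) (fun h => notMem_above hz₀ (h 0).1) hz0
  · refine PInv.of_imp fun j w hw m => ⟨((hK.good m).pinv_above j w).2 (hw m).1,
      fun z hz α hα => ?_⟩
    have := (hw m).2 (deckZ (-j) z) (((hK.good m).pinv _ z).2 hz) _
      (hα.deck (hK.good m).pinv_above (-j))
    rwa [neg_neg] at this
  · intro z w h1 h2 hz m
    have hsub := (hK.good m).vertical_subset_above (hz m).1 fun v hv α hα =>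
      abs_lt.2 ⟨(hz m).2 v hv α hα, hK.angle_lt_pi hv hα (hz m).1⟩
    have hzC : z ∈ pt z.1 '' Icc (ht z) 1 := ⟨ht z, ⟨le_rfl, ht_le_one z⟩, pt_ht z⟩
    have hwC : w ∈ pt z.1 '' Icc (ht z) 1 := ⟨ht w, ⟨h2, ht_le_one w⟩, by rw [h1, pt_ht]⟩
    refine ⟨hsub hwC, fun v hv α hα => ?_⟩
    have := hα.lt_of_vertical (isPreconnected_vertical _ _ _) hsub (x := z.1) (k := -1)
      (by rintro _ ⟨y, -, rfl⟩; rfl) hzC hwC (by simpa using (hz m).2 v hv α hα)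
    simpa using this
  · exact fun z hz => hK.ht_pos_of_mem_above (hz 0).1
  · intro z hz m
    have hzm := (hK.above_step m z).1 (hz (m + 1)).1
    refine ⟨hzm, fun v hv α hα => ?_⟩
    by_contra! hle
    have hv' := (hK.step m v).2 hv
    obtain ⟨β, hβ⟩ := (hK.good (m + 1)).exists_angle hv'
    have := hK.angle_step hα hβ (k := -1) hzm (by simpa using hle)
    push_cast at this
    linarith [(hz (m + 1)).2 _ hv' β hβ]

end StripTwist

theorem coe_circle_eq_iff {x y : ℝ} : (x : 𝕋) = y ↔ ∃ j : ℤ, x = y + j := by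
  rw [← sub_eq_zero, ← AddCircle.coe_sub, AddCircle.coe_eq_zero_iff]
  refine exists_congr fun j => ?_
  rw [zsmul_one]
  constructor <;> intro h <;> linarith

theorem not_nullhomotopic_id_circle : ¬ (ContinuousMap.id 𝕋).Nullhomotopic := by
  intro h
  have : ContractibleSpace 𝕋 := (contractible_iff_id_nullhomotopic 𝕋).2 h
  have : LocallyPathConnectedSpace 𝕋 :=
    (isQuotientMap_quotient_mk' (s := QuotientAddGroup.leftRel _)).locallyPathConnectedSpace
  obtain ⟨g, ⟨-, hg⟩, -⟩ := (AddCircle.isCoveringMap_coe (1 : ℝ)).existsUnique_continuousMap_lifts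
    (ContinuousMap.id 𝕋) 0 0 rfl
  have hg' : ∀ x : ℝ, ∃ j : ℤ, g x = x + j := fun x =>
    coe_circle_eq_iff.1 (congrFun hg (x : 𝕋))
  choose j hj using hg'
  have hc : Continuous fun x : ℝ => (j x : ℝ) := by
    have : (fun x : ℝ => (j x : ℝ)) = fun x : ℝ => g x - x := by
      ext x; rw [hj]; ring
    rw [this]
    exact (g.continuous.comp (AddCircle.continuous_mk' 1)).sub continuous_id
  have hjc : Continuous j := Int.isClosedEmbedding_coe_real.isEmbedding.continuous_iff.2 hc
  have h01 : j 0 = j 1 := PreconnectedSpace.constant inferInstance hjc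
  have h1 := hj 1
  rw [show ((1 : ℝ) : 𝕋) = (0 : ℝ) from coe_circle_eq_iff.2 ⟨1, by norm_num⟩, hj 0, h01] at h1
  linarith

/-- The circle map given by a periodic function has essential graph. -/
theorem isEssentialSimpleLoop_range {γ : C(𝕋, Ann)} (h : ∀ x, (γ x).1 = x) :
    IsEssentialSimpleLoop (range γ) := by
  refine ⟨γ, fun x y hxy => by rw [← h x, hxy, h y], fun hn => not_nullhomotopic_id_circle ?_, rfl⟩
  have := hn.comp_right ⟨Prod.fst, continuous_fst⟩
  convert this
  ext x
  exact (h x).symm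

theorem meetsVerticalsOnce_range {γ : C(𝕋, Ann)} (h : ∀ x, (γ x).1 = x) :
    MeetsVerticalsOnce (range γ) := by
  refine fun x => ⟨γ x, ⟨mem_range_self x, h x⟩, ?_⟩
  rintro _ ⟨⟨y, rfl⟩, hy⟩
  rw [← hy, h y]

theorem annProj_surjective : Function.Surjective annProj := fun a => by
  obtain ⟨x, hx⟩ := QuotientAddGroup.mk_surjective a.1
  exact ⟨(x, a.2), Prod.ext hx rfl⟩

theorem continuous_annProj : Continuous annProj :=
  ((AddCircle.continuous_mk' 1).comp continuous_fst).prodMk continuous_snd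

theorem isOpenMap_annProj : IsOpenMap annProj :=
  QuotientAddGroup.isOpenMap_coe.prodMap IsOpenMap.id

theorem annProj_eq_iff {z w : StripA} : annProj z = annProj w ↔ ∃ j, z = deckZ j w := by
  rw [Prod.ext_iff]
  change (z.1 : 𝕋) = w.1 ∧ z.2 = w.2 ↔ _
  rw [coe_circle_eq_iff]
  constructor
  · rintro ⟨⟨j, hj⟩, h⟩
    exact ⟨j, Prod.ext hj h⟩
  · rintro ⟨j, rfl⟩
    exact ⟨⟨j, rfl⟩, rfl⟩

theorem graph_of_noInvariantTransverseLoop {h : AnnulusHomeo} (hl : NoInvariantTransverseLoop h)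
    {φ : ℝ → ℝ} (hc : Continuous φ) (hp : ∀ x, φ (x + 1) = φ x) (h01 : ∀ x, φ x ∈ Icc (0:ℝ) 1)
    (hi : ∀ z, ht z = φ z.1 ↔ ht (h.lift z) = φ (h.lift z).1) :
    (∀ x, φ x = 0) ∨ (∀ x, φ x = 1) := by
  have hper : Function.Periodic (fun x => annProj (x, ⟨φ x, h01 x⟩)) 1 := fun x => by
    refine annProj_eq_iff.2 ⟨1, Prod.ext ?_ (Subtype.ext (hp x))⟩
    simp [deckZ]
  let γ : C(𝕋, Ann) := ⟨hper.lift, (continuous_annProj.comp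
    (continuous_id.prodMk (hc.subtype_mk h01))).quotient_lift _⟩
  have hγ : ∀ x : ℝ, γ x = annProj (x, ⟨φ x, h01 x⟩) := fun x => hper.lift_coe x
  have hfst : ∀ x, (γ x).1 = x := fun x => by
    obtain ⟨x, rfl⟩ := QuotientAddGroup.mk_surjective x
    exact congrArg Prod.fst (hγ x)
  have hmem : ∀ z : StripA, annProj z ∈ range γ ↔ ht z = φ z.1 := fun z => by
    constructor
    · rintro ⟨x, hx⟩
      have : x = (z.1 : 𝕋) := by rw [← hfst x, hx]; rfl
      rw [this, hγ] at hx
      exact (congrArg (fun a : Ann => (a.2 : ℝ)) hx).symm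
    · intro hz
      exact ⟨z.1, by rw [hγ]; exact congrArg annProj (Prod.ext rfl (Subtype.ext hz.symm))⟩
  have himage : h.toFun '' range γ = range γ := by
    ext a
    obtain ⟨w, rfl⟩ := annProj_surjective a
    obtain ⟨z, rfl⟩ := h.lift.surjective w
    rw [h.lift_proj, h.toFun.injective.mem_set_image, hmem, hi, ← hmem, h.lift_proj]
  refine (hl _ (isEssentialSimpleLoop_range hfst) (meetsVerticalsOnce_range hfst) himage).imp
    (fun e x => ?_) fun e x => ?_ <;>
  · have := e ▸ mem_range_self (x : 𝕋)
    rw [hγ] at this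
    exact this

/-- A diffeomorphism of the strip sends no interior point to the upper boundary line. -/
theorem snd_ne_one_of_hasFDerivWithinAt {F G : ℝ × ℝ → ℝ × ℝ} {A B : (ℝ × ℝ) →L[ℝ] (ℝ × ℝ)}
    {z : ℝ × ℝ} (hz : z.2 ∈ Ioo (0:ℝ) 1) (hF : HasFDerivWithinAt F A stripS z)
    (hG : HasFDerivWithinAt G B stripS (F z)) (hmaps : MapsTo F stripS stripS)
    (hGF : ∀ p ∈ stripS, G (F p) = p) : (F z).2 ≠ 1 := by
  intro h1
  have hnhds : stripS ∈ 𝓝 z := mem_of_superset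
    ((isOpen_Ioo.preimage continuous_snd).mem_nhds hz) fun p hp => Ioo_subset_Icc_self hp
  have hBA : B.comp A = ContinuousLinearMap.id ℝ (ℝ × ℝ) := by
    refine ((hG.comp z hF hmaps).hasFDerivAt hnhds).unique
      ((hasFDerivAt_id z).congr_of_eventuallyEq ?_)
    filter_upwards [hnhds] with p hp
    exact hGF p hp
  have hmax : IsLocalMax (fun p => (F p).2) z := by
    filter_upwards [hnhds] with p hp
    rw [h1]
    exact (hmaps hp).2
  have h0 := hmax.hasFDerivAt_eq_zero (hF.hasFDerivAt hnhds).snd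
  have hinj : Function.Injective (A : (ℝ × ℝ) →ₗ[ℝ] (ℝ × ℝ)) :=
    Function.LeftInverse.injective (g := B) fun v => congrArg (fun C => C v) hBA
  obtain ⟨v, hv⟩ := LinearMap.injective_iff_surjective.1 hinj (0, 1)
  have h2 := congrArg (fun C => C v) h0
  have hv' : A v = (0, 1) := hv
  simp [hv'] at h2

end TwistStrip

section

open TwistStrip

theorem AnnulusHomeo.lift_deckZ (h : AnnulusHomeo) : Equivariant h.lift := by
  intro j z
  induction j with
  | zero => simp
  | succ i ih =>
    rw [add_comm, ← deckZ_deckZ, ← deckZ_deckZ, ← ih]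
    have := h.lift_deck (deckZ i z)
    simpa [deckT, deckZ] using this
  | pred i ih =>
    have := h.lift_deck (deckZ (-i - 1) z)
    have e1 : deckT (deckZ (-i - 1) z) = deckZ (-i) z := strip_ext (by simp [deckT]; ring) rfl
    have e2 : deckZ (-i) (h.lift z) = deckT (deckZ (-i - 1) (h.lift z)) :=
      strip_ext (by simp [deckT]; ring) rfl
    rw [e1, ih, e2] at this
    refine strip_ext ?_ ?_
    · have := congrArg Prod.fst this
      simp only [deckT] at this
      linarith
    · exact (congrArg ht this).symm

theorem AnnulusHomeo.lift_pt_zero_strictMono (h : AnnulusHomeo) :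
    StrictMono fun x : ℝ => (h.lift (pt x 0)).1 := by
  have hc : Continuous fun x : ℝ => (h.lift (pt x 0)).1 :=
    continuous_fst.comp (h.lift.continuous.comp
      (continuous_pt.comp (continuous_id.prodMk continuous_const)))
  have h0 : ∀ x, ht (h.lift (pt x 0)) = 0 := fun x => h.lift_bd0 _ (ht_pt le_rfl zero_le_one)
  have hinj : Function.Injective fun x : ℝ => (h.lift (pt x 0)).1 := fun x y hxy =>
    congrArg Prod.fst (h.lift.injective (strip_ext hxy ((h0 x).trans (h0 y).symm)))
  refine (hc.strictMono_of_inj hinj).resolve_right fun ha => ?_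
  have h1 := ha zero_lt_one
  have h2 := congrArg Prod.fst (h.lift_deckZ 1 (pt 0 0))
  rw [show deckZ 1 (pt 0 0) = pt 1 0 from strip_ext (by simp) rfl] at h2
  simp only [deckZ_fst] at h2
  norm_num at h2
  linarith

theorem AnnulusHomeo.ht_lift_eq_zero_iff (h : AnnulusHomeo) (z : StripA) :
    ht (h.lift z) = 0 ↔ ht z = 0 := by
  refine ⟨fun hz => ?_, h.lift_bd0 z⟩
  have hc : Continuous fun x : ℝ => (h.lift (pt x 0)).1 :=
    continuous_fst.comp (h.lift.continuous.comp
      (continuous_pt.comp (continuous_id.prodMk continuous_const)))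
  have hj : ∀ j : ℤ, (h.lift (pt j 0)).1 = (h.lift (pt 0 0)).1 + j := fun j => by
    rw [show pt j 0 = deckZ j (pt 0 0) from strip_ext (by simp) rfl, AnnulusHomeo.lift_deckZ]
    rfl
  have hsurj : Function.Surjective fun x : ℝ => (h.lift (pt x 0)).1 := by
    refine hc.surjective
      (h.lift_pt_zero_strictMono.monotone.tendsto_atTop_atTop fun b => ?_)
      (h.lift_pt_zero_strictMono.monotone.tendsto_atBot_atBot fun b => ?_)
    · obtain ⟨n, hn⟩ := exists_int_gt (b - (h.lift (pt 0 0)).1)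
      exact ⟨n, by rw [hj]; linarith⟩
    · obtain ⟨n, hn⟩ := exists_int_lt (b - (h.lift (pt 0 0)).1)
      exact ⟨n, by rw [hj]; linarith⟩
  obtain ⟨x, hx⟩ := hsurj (h.lift z).1
  have hx0 : ht (pt x 0) = 0 := ht_pt le_rfl zero_le_one
  rw [← h.lift.injective (strip_ext hx ((h.lift_bd0 _ hx0).trans hz.symm)), hx0]

theorem PositiveTwistMap.mapsTo_F (f : PositiveTwistMap) : MapsTo f.F stripS stripS := by
  intro p hp
  rw [show p = (((p.1, ⟨p.2, hp⟩) : StripA).1, (((p.1, ⟨p.2, hp⟩) : StripA).2 : ℝ)) from rfl,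
    f.F_lift]
  exact (f.lift _).2.2

theorem PositiveTwistMap.mapsTo_G (f : PositiveTwistMap) : MapsTo f.G stripS stripS := by
  intro p hp
  rw [show p = (((p.1, ⟨p.2, hp⟩) : StripA).1, (((p.1, ⟨p.2, hp⟩) : StripA).2 : ℝ)) from rfl,
    f.G_lift]
  exact (f.lift.symm _).2.2

theorem PositiveTwistMap.ht_lift_ne_one (f : PositiveTwistMap) {z : StripA} (hz : ht z ≠ 1) :
    ht (f.lift z) ≠ 1 := by
  rcases (ht_nonneg z).eq_or_lt with h0 | h0
  · rw [(AnnulusHomeo.ht_lift_eq_zero_iff _ z).2 h0.symm]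
    exact zero_ne_one
  have hF := f.F_lift z
  have := snd_ne_one_of_hasFDerivWithinAt (z := (z.1, (z.2 : ℝ))) (G := f.G)
    ⟨h0, (ht_le_one z).lt_of_ne hz⟩ (f.F_hasDeriv _ z.2.2)
    (f.G_hasDeriv _ (f.mapsTo_F z.2.2)) f.mapsTo_F fun p hp => by
      have e := f.F_lift (p.1, ⟨p.2, hp⟩)
      have e' := f.G_lift (f.lift (p.1, ⟨p.2, hp⟩))
      rw [← e, Homeomorph.symm_apply_apply] at e'
      exact e'
  rwa [hF] at this

theorem PositiveTwistMap.ht_lift_symm_ne_one (f : PositiveTwistMap) {z : StripA} (hz : ht z ≠ 1) :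
    ht (f.lift.symm z) ≠ 1 := by
  rcases (ht_nonneg z).eq_or_lt with h0 | h0
  · rw [(f.toAnnulusHomeo.ht_lift_eq_zero_iff (f.lift.symm z)).1
      (by rw [Homeomorph.apply_symm_apply, h0])]
    exact zero_ne_one
  have hG := f.G_lift z
  have := snd_ne_one_of_hasFDerivWithinAt (z := (z.1, (z.2 : ℝ))) (G := f.F)
    ⟨h0, (ht_le_one z).lt_of_ne hz⟩ (f.G_hasDeriv _ z.2.2)
    (f.F_hasDeriv _ (f.mapsTo_G z.2.2)) f.mapsTo_G
    fun p hp => by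
      have e := f.G_lift (p.1, ⟨p.2, hp⟩)
      have e' := f.F_lift (f.lift.symm (p.1, ⟨p.2, hp⟩))
      rw [← e, Homeomorph.apply_symm_apply] at e'
      exact e'
  rwa [hG] at this

theorem PositiveTwistMap.ht_lift_eq_one_iff (f : PositiveTwistMap) (z : StripA) :
    ht (f.lift z) = 1 ↔ ht z = 1 :=
  ⟨fun h => by_contra fun hz => f.ht_lift_ne_one hz h, fun h => by_contra fun hz =>
    f.ht_lift_symm_ne_one hz (by rw [Homeomorph.symm_apply_apply, h])⟩

theorem PositiveTwistMap.lift_fst_lt (f : PositiveTwistMap) {z w : StripA} (h1 : z.1 = w.1)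
    (h2 : ht z < ht w) : (f.lift z).1 < (f.lift w).1 := by
  have hd : ∀ y ∈ Icc (0:ℝ) 1, HasDerivWithinAt (fun y => (f.F (z.1, y)).1)
      (f.F' (z.1, y) (0, 1)).1 (Icc 0 1) y := fun y hy =>
    ((f.F_hasDeriv (z.1, y) hy).fst).comp_hasDerivWithinAt y
      (((hasDerivAt_const y z.1).prodMk (hasDerivAt_id y)).hasDerivWithinAt) fun t ht => ht
  have hmono : StrictMonoOn (fun y => (f.F (z.1, y)).1) (Icc 0 1) := by
    refine strictMonoOn_of_deriv_pos (convex_Icc 0 1) (fun y hy => (hd y hy).continuousWithinAt)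
      fun y hy => ?_
    rw [interior_Icc] at hy
    rw [((hd y (Ioo_subset_Icc_self hy)).hasDerivAt (Icc_mem_nhds hy.1 hy.2)).deriv]
    exact f.twist_pos _ (Ioo_subset_Icc_self hy)
  have := hmono z.2.2 w.2.2 h2
  simp only at this
  rwa [f.F_lift z, h1, f.F_lift w] at this

theorem PositiveTwistMap.lift_symm_fst_lt (f : PositiveTwistMap) {z w : StripA} (h1 : z.1 = w.1)
    (h2 : ht z < ht w) : (f.lift.symm w).1 < (f.lift.symm z).1 := by
  have hc : Continuous fun y => (f.lift.symm (pt z.1 y)).1 :=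
    continuous_fst.comp (f.lift.symm.continuous.comp (continuous_pt_right _))
  have hinj : InjOn (fun y => (f.lift.symm (pt z.1 y)).1) (Icc 0 1) := by
    intro a ha b hb hab
    have key : ht (f.lift.symm (pt z.1 a)) = ht (f.lift.symm (pt z.1 b)) := by
      rcases lt_trichotomy (ht (f.lift.symm (pt z.1 a))) (ht (f.lift.symm (pt z.1 b)))
        with h | h | h
      · have := f.lift_fst_lt hab h
        simp at this
      · exact h
      · have := f.lift_fst_lt hab.symm h
        simp at this
    have := congrArg ht (f.lift.symm.injective (strip_ext hab key))
    rwa [ht_pt ha.1 ha.2, ht_pt hb.1 hb.2] at this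
  have hanti := (hc.continuousOn.strictMonoOn_of_injOn_Icc' zero_le_one hinj).resolve_left
    fun hm => by
      have hu := hm (left_mem_Icc.2 zero_le_one) (right_mem_Icc.2 zero_le_one) zero_lt_one
      simp only at hu
      set u := f.lift.symm (pt z.1 0)
      set v := f.lift.symm (pt z.1 1)
      have hu' : f.lift u = pt z.1 0 := f.lift.apply_symm_apply _
      have hv' : f.lift v = pt z.1 1 := f.lift.apply_symm_apply _
      have hu0 : ht u = 0 := (AnnulusHomeo.ht_lift_eq_zero_iff _ u).1
        (by rw [hu', ht_pt le_rfl zero_le_one])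
      have hv1 : ht v = 1 := (f.ht_lift_eq_one_iff v).1
        (by rw [hv', ht_pt zero_le_one le_rfl])
      have hb := f.lift_pt_zero_strictMono hu
      have hlt := f.lift_fst_lt (z := pt v.1 0) (w := v) rfl
        (by rw [ht_pt le_rfl zero_le_one, hv1]; exact zero_lt_one)
      simp only at hb
      rw [show pt u.1 0 = u by rw [← pt_ht u, hu0, pt_fst], hu'] at hb
      rw [hv'] at hlt
      exact lt_asymm hb hlt
  have := hanti z.2.2 w.2.2 h2
  simp only at this
  rw [show pt z.1 z.2 = z from pt_ht z, h1, show pt w.1 w.2 = w from pt_ht w] at this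
  exact this

theorem AnnulusHomeo.iter_natCast (h : AnnulusHomeo) (n : ℕ) (a : Ann) :
    h.iter n a = h.toFun^[n] a := by
  rw [AnnulusHomeo.iter, zpow_natCast, ← Equiv.Perm.iterate_eq_pow]
  rfl

theorem AnnulusHomeo.iter_neg_natCast (h : AnnulusHomeo) (n : ℕ) (a : Ann) :
    h.iter (-n) a = h.toFun.symm^[n] a := by
  rw [AnnulusHomeo.iter, zpow_neg, zpow_natCast, ← inv_pow, ← Equiv.Perm.iterate_eq_pow]
  rfl

theorem AnnulusHomeo.annProj_iterate (h : AnnulusHomeo) (n : ℕ) (z : StripA) :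
    annProj (h.lift^[n] z) = h.toFun^[n] (annProj z) :=
  (show Function.Semiconj annProj h.lift h.toFun from h.lift_proj).iterate_right n z

theorem AnnulusHomeo.annProj_symm_iterate (h : AnnulusHomeo) (n : ℕ) (z : StripA) :
    annProj (h.lift.symm^[n] z) = h.toFun.symm^[n] (annProj z) := by
  refine (show Function.Semiconj annProj h.lift.symm h.toFun.symm from fun w => ?_).iterate_right
    n z
  rw [eq_comm, Homeomorph.symm_apply_eq, ← h.lift_proj, Homeomorph.apply_symm_apply]

theorem NonWandering.exists_ge {h : AnnulusHomeo} (hw : NonWandering h) (N : ℕ) {U : Set Ann}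
    (hU : IsOpen U) (hne : U.Nonempty) : ∃ k ≥ N, ∃ a ∈ U, h.toFun^[k] a ∈ U := by
  induction N generalizing U with
  | zero => exact ⟨0, le_rfl, hne.some, hne.some_mem, hne.some_mem⟩
  | succ N ih =>
    obtain ⟨k, hk, -, ⟨a, ha, rfl⟩, ha'⟩ := hw U hU hne
    rw [AnnulusHomeo.iter_natCast] at ha'
    obtain ⟨l, hl, b, hb, hb'⟩ := ih (U := U ∩ h.toFun^[k] ⁻¹' U)
      (hU.inter (hU.preimage (h.toFun.continuous.iterate k))) ⟨a, ha, ha'⟩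
    exact ⟨k + l, by omega, b, hb.1, by rw [Function.iterate_add_apply]; exact hb'.2⟩

theorem NonWandering.recurrent_lift {h : AnnulusHomeo} (hw : NonWandering h) :
    Recurrent h.lift := by
  intro U hU hne N
  obtain ⟨k, hk, _, ⟨w, hw, rfl⟩, v, hv, hvw⟩ :=
    hw.exists_ge N (isOpenMap_annProj U hU) (hne.image annProj)
  rw [← AnnulusHomeo.annProj_iterate] at hvw
  obtain ⟨j, rfl⟩ := annProj_eq_iff.1 hvw
  exact ⟨k, hk, w, hw, j, hv⟩

/-- The lift to the strip of a non wandering twist map without invariant graphs. -/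
noncomputable def PositiveTwistMap.stripTwist (f : PositiveTwistMap)
    (hnw : NonWandering f.toAnnulusHomeo)
    (hl : NoInvariantTransverseLoop f.toAnnulusHomeo) : StripTwist where
  F := f.lift
  equi := AnnulusHomeo.lift_deckZ _
  bot := AnnulusHomeo.ht_lift_eq_zero_iff _
  top := f.ht_lift_eq_one_iff
  twist _ _ := f.lift_fst_lt
  symm_twist _ _ := f.lift_symm_fst_lt
  recur := hnw.recurrent_lift
  graph _ := graph_of_noInvariantTransverseLoop hl

theorem infDist_C0_le (z : StripA) : Metric.infDist (annProj z) C0 ≤ ht z := by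
  refine (Metric.infDist_le_dist_of_mem (y := annProj (pt z.1 0)) ?_).trans ?_
  · exact ht_pt (x := z.1) le_rfl zero_le_one
  · rw [Prod.dist_eq]
    refine max_le ?_ ?_
    · rw [show (annProj z).1 = (annProj (pt z.1 0)).1 from rfl, dist_self]
      exact ht_nonneg z
    · rw [Subtype.dist_eq, Real.dist_eq]
      change |ht z - ht (pt z.1 0)| ≤ _
      rw [ht_pt le_rfl zero_le_one, sub_zero, abs_of_nonneg (ht_nonneg z)]

theorem infDist_C1_le (z : StripA) : Metric.infDist (annProj z) C1 ≤ 1 - ht z := by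
  refine (Metric.infDist_le_dist_of_mem (y := annProj (pt z.1 1)) ?_).trans ?_
  · exact ht_pt (x := z.1) zero_le_one le_rfl
  · have := ht_le_one z
    rw [Prod.dist_eq]
    refine max_le ?_ ?_
    · rw [show (annProj z).1 = (annProj (pt z.1 1)).1 from rfl, dist_self]
      linarith
    · rw [Subtype.dist_eq, Real.dist_eq]
      change |ht z - ht (pt z.1 1)| ≤ _
      rw [ht_pt zero_le_one le_rfl, abs_of_nonpos (by linarith)]
      linarith

theorem tendsto_infDist_C0 {α : Type*} {l : Filter α} {u : α → StripA}
    (h : Tendsto (fun n => ht (u n)) l (𝓝 0)) :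
    Tendsto (fun n => Metric.infDist (annProj (u n)) C0) l (𝓝 0) :=
  squeeze_zero (fun _ => Metric.infDist_nonneg) (fun n => infDist_C0_le (u n)) h

theorem tendsto_infDist_C1 {α : Type*} {l : Filter α} {u : α → StripA}
    (h : Tendsto (fun n => ht (u n)) l (𝓝 1)) :
    Tendsto (fun n => Metric.infDist (annProj (u n)) C1) l (𝓝 0) :=
  squeeze_zero (fun _ => Metric.infDist_nonneg) (fun n => infDist_C1_le (u n))
    (by simpa using h.const_sub 1)

theorem tendsto_int_atTop {u : ℤ → ℝ} {l : Filter ℝ} (h : Tendsto (fun n : ℕ => u n) atTop l) :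
    Tendsto u atTop l := by
  rw [← Nat.map_cast_int_atTop]
  exact tendsto_map'_iff.2 h

theorem tendsto_int_atBot {u : ℤ → ℝ} {l : Filter ℝ}
    (h : Tendsto (fun n : ℕ => u (-n)) atTop l) : Tendsto u atBot l := by
  have := (tendsto_int_atTop (u := fun k => u (-k)) h).comp tendsto_neg_atBot_atTop
  simpa [Function.comp_def] using this

theorem AnnulusHomeo.tendsto_iter_atTop {h : AnnulusHomeo} {z : StripA} {S : Set Ann}
    (hz : Tendsto (fun n => Metric.infDist (annProj (h.lift^[n] z)) S) atTop (𝓝 0)) :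
    Tendsto (fun k : ℤ => Metric.infDist (h.iter k (annProj z)) S) atTop (𝓝 0) :=
  tendsto_int_atTop (by simpa only [iter_natCast, ← annProj_iterate] using hz)

theorem AnnulusHomeo.tendsto_iter_atBot {h : AnnulusHomeo} {z : StripA} {S : Set Ann}
    (hz : Tendsto (fun n => Metric.infDist (annProj (h.lift.symm^[n] z)) S) atTop (𝓝 0)) :
    Tendsto (fun k : ℤ => Metric.infDist (h.iter k (annProj z)) S) atBot (𝓝 0) :=
  tendsto_int_atBot (by simpa only [iter_neg_natCast, ← annProj_symm_iterate] using hz)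

theorem TwistStrip.StripTwist.exists_orbit_from_top_to_bottom (f : StripTwist) :
    ∃ z, 0 < ht z ∧ ht z < 1 ∧
    Tendsto (fun n => ht (f.F.symm^[n] z)) atTop (𝓝 1) ∧
    Tendsto (fun n => ht (f.F^[n] z)) atTop (𝓝 0) := by
  obtain ⟨z, h0, h1, hb, ht'⟩ := f.turn.exists_connects
  have hF : ∀ n, f.turn.F^[n] z = halfTurn (f.F^[n] (halfTurn z)) := fun n =>
    iterate_conj halfTurn_halfTurn n z
  have hsymm : f.turn.F.symm = halfTurn.trans (f.F.symm.trans halfTurn) := by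
    ext1 w
    rw [Homeomorph.symm_apply_eq]
    simp [StripTwist.turn]
  have hG : ∀ n, f.turn.F.symm^[n] z = halfTurn (f.F.symm^[n] (halfTurn z)) := fun n => by
    rw [hsymm]
    exact iterate_conj halfTurn_halfTurn n z
  simp only [hF, hG, ht_halfTurn] at hb ht'
  refine ⟨halfTurn z, by simp [h1], by simp [h0], ?_, ?_⟩
  · simpa using hb.const_sub 1
  · simpa using ht'.const_sub 1

end

/-- **Mather's theorem, twist map version.** A non wandering positive twist map with no
invariant essential simple loop transverse to the verticals, except `C₀` and `C₁`, has
orbits going from one boundary circle to the other, in both directions. -/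
theorem statement5 (f : PositiveTwistMap) (hnw : NonWandering f.toAnnulusHomeo)
    (hNoLoop : NoInvariantTransverseLoop f.toAnnulusHomeo) :
    (∃ z : Ann, (z.2 : ℝ) ∈ Set.Ioo (0:ℝ) 1 ∧
      Tendsto (fun k : ℤ => Metric.infDist (f.toAnnulusHomeo.iter k z) C0) atBot (𝓝 0) ∧
      Tendsto (fun k : ℤ => Metric.infDist (f.toAnnulusHomeo.iter k z) C1) atTop (𝓝 0)) ∧
    (∃ z' : Ann, (z'.2 : ℝ) ∈ Set.Ioo (0:ℝ) 1 ∧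
      Tendsto (fun k : ℤ => Metric.infDist (f.toAnnulusHomeo.iter k z') C1) atBot (𝓝 0) ∧
      Tendsto (fun k : ℤ => Metric.infDist (f.toAnnulusHomeo.iter k z') C0) atTop (𝓝 0)) := by
  constructor
  · obtain ⟨z, h0, h1, hb, ht⟩ := (f.stripTwist hnw hNoLoop).exists_connects
    exact ⟨annProj z, ⟨h0, h1⟩,
      AnnulusHomeo.tendsto_iter_atBot (tendsto_infDist_C0 hb),
      AnnulusHomeo.tendsto_iter_atTop (tendsto_infDist_C1 ht)⟩
  · obtain ⟨z, h0, h1, hb, ht⟩ := (f.stripTwist hnw hNoLoop).exists_orbit_from_top_to_bottom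
    exact ⟨annProj z, ⟨h0, h1⟩,
      AnnulusHomeo.tendsto_iter_atBot (tendsto_infDist_C1 hb),
      AnnulusHomeo.tendsto_iter_atTop (tendsto_infDist_C0 ht)⟩
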